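/- Let k ≥ 2 and n ≥ 1 be natural numbers. If C is a metric continuum with dim C = kn (Lebesgue covering dimension), then X_C = Z(C,C) is a compact Fréchet space such that: (a) ∂Δ^k-dim X_C = ∂Δ^k-Ind X_C = n; (b) |∂Δ^k|-Ind X_C = n + 1; and (c) each connected component of X_C is homeomorphic to C. (In particular, the equality K-Ind = |K|-Ind fails outside the class of hereditarily normal spaces.) -/

import Mathlib

open Set Topology Cardinal

noncomputable section

attribute [local instance] Classical.propDecidable

/-- Values of dimension functions: `⊥ : WithBot Ordinal.{0}` encodes `−1`,
ordinals are the usual values, and `⊤` encodes `∞`. -/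
abbrev Dim : Type 1 := WithTop (WithBot Ordinal.{0})

/-- An ordinal viewed as a dimension value. -/
def Dim.ofOrdinal (a : Ordinal.{0}) : Dim := ((a : WithBot Ordinal.{0}) : Dim)

/-- The dimension value `−1`. -/
def Dim.minusOne : Dim := ((⊥ : WithBot Ordinal.{0}) : Dim)

/-- An integer `m ≥ −1` viewed as a dimension value. -/
def Dim.ofInt (m : ℤ) : Dim := if 0 ≤ m then Dim.ofOrdinal m.toNat else Dim.minusOne

/-- `A` is a `K`-tuple for the simplicial complex `K` on the vertex set `Fin m`:
whenever the members indexed by a nonempty `I` have a common point, `I` spans a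
simplex of `K`. -/
def IsKTuple {m : ℕ} (K : Finset (Fin m) → Prop) {X : Type} (A : Fin m → Set X) : Prop :=
  ∀ I : Finset (Fin m), I.Nonempty → (⋂ i ∈ I, A i).Nonempty → K I

/-- `K` is an abstract (finite) simplicial complex with vertex set `Fin m`:
it is closed under passing to nonempty subsets, and contains every vertex. -/
def IsComplex {m : ℕ} (K : Finset (Fin m) → Prop) : Prop :=
  (∀ s t : Finset (Fin m), s ⊆ t → s.Nonempty → K t → K s) ∧ ∀ i, K {i}

/-- The boundary complex `∂Δ^k` of the `k`-simplex: all proper subsets of the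
`k+1` vertices span simplices. -/
def bComplex (k : ℕ) : Finset (Fin (k + 1)) → Prop := fun s => s ≠ Finset.univ

/-- `U` is an (open) `K`-neighbourhood of the tuple `F`. -/
def KNbhd {m : ℕ} (K : Finset (Fin m) → Prop) {X : Type} [TopologicalSpace X]
    (F U : Fin m → Set X) : Prop :=
  (∀ i, IsOpen (U i)) ∧ IsKTuple K U ∧ ∀ i, F i ⊆ U i

/-- Auxiliary form of `K-Ind X ≤ α`, defined by transfinite recursion on `α`:
every closed `K`-tuple has a `K`-neighbourhood whose corresponding `K`-partition
is either empty (dimension `−1`) or has `K-Ind < α`. -/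
def KIndLeAux {m : ℕ} (K : Finset (Fin m) → Prop) :
    Ordinal.{0} → ∀ X : Type, TopologicalSpace X → Prop :=
  (wellFounded_lt (α := Ordinal.{0})).fix fun α rec X tX =>
    letI := tX
    ∀ F : Fin m → Set X, (∀ i, IsClosed (F i)) → IsKTuple K F →
      ∃ U : Fin m → Set X, (∀ i, IsOpen (U i)) ∧ IsKTuple K U ∧ (∀ i, F i ⊆ U i) ∧
        ((⋃ i, U i)ᶜ = (∅ : Set X) ∨
          ∃ β : Set.Iio α, rec β.1 β.2 (↥((⋃ i, U i)ᶜ)) inferInstance)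

/-- `K-Ind X ≤ α` (for an ordinal `α ≥ 0`). -/
def KIndLE {m : ℕ} (K : Finset (Fin m) → Prop) (X : Type) [tX : TopologicalSpace X]
    (α : Ordinal.{0}) : Prop :=
  KIndLeAux K α X tX

/-- Fedorchuk's inductive dimension `K-Ind` modulo a simplicial complex `K`;
`−1` for the empty space, the least `α` with `K-Ind X ≤ α` otherwise, `∞` if none. -/
def KInd {m : ℕ} (K : Finset (Fin m) → Prop) (X : Type) [TopologicalSpace X] : Dim :=
  if IsEmpty X then Dim.minusOne
  else if ∃ α, KIndLE K X α then Dim.ofOrdinal (sInf {α | KIndLE K X α}) else ⊤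

/-- The set of `K`-obstruction points of an open `K`-tuple `U`: points covered
by no `K`-neighbourhood of `U`. -/
def KObs {m : ℕ} (K : Finset (Fin m) → Prop) {X : Type} [TopologicalSpace X]
    (U : Fin m → Set X) : Set X :=
  {x | ¬ ∃ V : Fin m → Set X, KNbhd K U V ∧ x ∈ ⋃ i, V i}

/-- `X` is strongly `α`-dimensional: `K-Ind X` is a positive ordinal `α` and some
closed `K`-tuple admits no `K`-neighbourhood `U` without obstruction points whose
corresponding `K`-partition has `K-Ind < α`. -/
def KStrongly {m : ℕ} (K : Finset (Fin m) → Prop) (X : Type) [TopologicalSpace X] : Prop :=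
  (∃ α : Ordinal.{0}, 0 < α ∧ KInd K X = Dim.ofOrdinal α) ∧
  ∃ F : Fin m → Set X, (∀ i, IsClosed (F i)) ∧ IsKTuple K F ∧
    ∀ U : Fin m → Set X, KNbhd K F U →
      KInd K (↥((⋃ i, U i)ᶜ)) < KInd K X → KObs K U ≠ ∅

/-- The dimensional strength degree `K-str X ∈ {0,1}`. -/
def KStr {m : ℕ} (K : Finset (Fin m) → Prop) (X : Type) [TopologicalSpace X] : ℕ :=
  if KStrongly K X then 1 else 0

/-- `K-dim X ≤ n`: any `n+1` closed `K`-tuples admit `K`-partitions with empty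
intersection. -/
def KDimLE {m : ℕ} (K : Finset (Fin m) → Prop) (X : Type) [TopologicalSpace X] (n : ℕ) : Prop :=
  ∀ F : Fin (n + 1) → Fin m → Set X,
    (∀ j i, IsClosed (F j i)) → (∀ j, IsKTuple K (F j)) →
    ∃ U : Fin (n + 1) → Fin m → Set X, (∀ j, KNbhd K (F j) (U j)) ∧
      (⋂ j, (⋃ i, U j i)ᶜ) = (∅ : Set X)

/-- Fedorchuk's dimension `K-dim` modulo a simplicial complex `K`. -/
def KDim {m : ℕ} (K : Finset (Fin m) → Prop) (X : Type) [TopologicalSpace X] : Dim :=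
  if IsEmpty X then Dim.minusOne
  else if ∃ n, KDimLE K X n then Dim.ofOrdinal ((sInf {n | KDimLE K X n} : ℕ) : Ordinal.{0}) else ⊤

/-- `dim X ≤ n` for the Lebesgue covering dimension: every finite open cover has
an open shrinking of order at most `n+1`. -/
def CovDimLE (X : Type) [TopologicalSpace X] (n : ℕ) : Prop :=
  ∀ (ι : Type), Finite ι → ∀ U : ι → Set X, (∀ i, IsOpen (U i)) → (⋃ i, U i) = Set.univ →
    ∃ V : ι → Set X, (∀ i, IsOpen (V i)) ∧ (∀ i, V i ⊆ U i) ∧ (⋃ i, V i) = Set.univ ∧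
      ∀ x : X, ({i | x ∈ V i}).ncard ≤ n + 1

/-- The Lebesgue covering dimension. -/
def covDim (X : Type) [TopologicalSpace X] : Dim :=
  if IsEmpty X then Dim.minusOne
  else if ∃ n, CovDimLE X n then Dim.ofOrdinal ((sInf {n | CovDimLE X n} : ℕ) : Ordinal.{0}) else ⊤

/-- `Ind X ≤ n` for the large inductive dimension, by recursion on `n`. -/
def IndLE : ℕ → ∀ X : Type, TopologicalSpace X → Prop
  | 0, X, tX =>
    letI := tX
    ∀ F U : Set X, IsClosed F → IsOpen U → F ⊆ U →
      ∃ V : Set X, IsOpen V ∧ F ⊆ V ∧ V ⊆ U ∧ frontier V = ∅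
  | n + 1, X, tX =>
    letI := tX
    ∀ F U : Set X, IsClosed F → IsOpen U → F ⊆ U →
      ∃ V : Set X, IsOpen V ∧ F ⊆ V ∧ V ⊆ U ∧ IndLE n (↥(frontier V)) inferInstance

/-- The large inductive dimension `Ind`. -/
def IndDim (X : Type) [tX : TopologicalSpace X] : Dim :=
  if IsEmpty X then Dim.minusOne
  else if ∃ n, IndLE n X tX then Dim.ofOrdinal ((sInf {n | IndLE n X tX} : ℕ) : Ordinal.{0}) else ⊤

/-- The relation generating the topological join `A ∗ B`: the copy of `B` is
collapsed at parameter `0`, the copy of `A` at parameter `1`. -/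
def JoinRel (A B : Type) : (A × B × unitInterval) → (A × B × unitInterval) → Prop :=
  fun p q => (p.2.2 = 0 ∧ q.2.2 = 0 ∧ p.1 = q.1) ∨ (p.2.2 = 1 ∧ q.2.2 = 1 ∧ p.2.1 = q.2.1)

/-- The topological join `A ∗ B`. -/
abbrev Join (A B : Type) [TopologicalSpace A] [TopologicalSpace B] : Type :=
  Quot (JoinRel A B)

/-- Auxiliary construction of the join of `n+1` copies of `L`, bundled with its
topology. -/
def JoinPowAux (L : Type) (tL : TopologicalSpace L) : ℕ → (T : Type) × TopologicalSpace T
  | 0 => ⟨L, tL⟩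
  | n + 1 =>
    let p := JoinPowAux L tL n
    letI := tL
    letI := p.2
    ⟨Join L p.1, inferInstance⟩

/-- The join `L ∗ ⋯ ∗ L` of `n+1` copies of `L`. -/
def JoinPow (L : Type) [tL : TopologicalSpace L] (n : ℕ) : Type :=
  (JoinPowAux L tL n).1

instance joinPowTopologicalSpace (L : Type) [tL : TopologicalSpace L] (n : ℕ) :
    TopologicalSpace (JoinPow L n) :=
  (JoinPowAux L tL n).2

/-- `L-dim X ≤ n`: every continuous map from a closed subset of `X` to the join
of `n+1` copies of `L` extends continuously over `X`. -/
def LDimLE (L : Type) [TopologicalSpace L] (X : Type) [TopologicalSpace X] (n : ℕ) : Prop :=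
  ∀ F : Set X, IsClosed F → ∀ f : C(F, JoinPow L n),
    ∃ g : C(X, JoinPow L n), ∀ x : F, g x = f x

/-- Fedorchuk's dimension `L-dim` modulo an ANR `L`. -/
def LDim (L : Type) [TopologicalSpace L] (X : Type) [TopologicalSpace X] : Dim :=
  if IsEmpty X then Dim.minusOne
  else if ∃ n, LDimLE L X n then Dim.ofOrdinal ((sInf {n | LDimLE L X n} : ℕ) : Ordinal.{0}) else ⊤

/-- Auxiliary form of `L-Ind X ≤ α`, by transfinite recursion on `α`: every map
to `L` from a closed subset of `X` has an `L`-partition which is either empty or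
has `L-Ind < α`. -/
def LIndLeAux (L : Type) [TopologicalSpace L] :
    Ordinal.{0} → ∀ X : Type, TopologicalSpace X → Prop :=
  (wellFounded_lt (α := Ordinal.{0})).fix fun α rec X tX =>
    letI := tX
    ∀ F : Set X, IsClosed F → ∀ f : C(F, L),
      ∃ U : Set X, IsOpen U ∧ ∃ hFU : F ⊆ U,
        (∃ g : C(U, L), ∀ (x : X) (hx : x ∈ F), g ⟨x, hFU hx⟩ = f ⟨x, hx⟩) ∧
        (Uᶜ = (∅ : Set X) ∨ ∃ β : Set.Iio α, rec β.1 β.2 (↥(Uᶜ)) inferInstance)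

/-- `L-Ind X ≤ α` (for an ordinal `α ≥ 0`). -/
def LIndLE (L : Type) [TopologicalSpace L] (X : Type) [tX : TopologicalSpace X]
    (α : Ordinal.{0}) : Prop :=
  LIndLeAux L α X tX

/-- Fedorchuk's inductive dimension `L-Ind` modulo an ANR `L`. -/
def LInd (L : Type) [TopologicalSpace L] (X : Type) [TopologicalSpace X] : Dim :=
  if IsEmpty X then Dim.minusOne
  else if ∃ α, LIndLE L X α then Dim.ofOrdinal (sInf {α | LIndLE L X α}) else ⊤

/-- `L` is an absolute neighbourhood retract (for metric spaces): `L` is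
metrizable and whenever a closed subset `A` of a metric space is homeomorphic to
`L` via `e`, the map `e` extends continuously over a neighbourhood of `A`. -/
def IsANR (L : Type) [TopologicalSpace L] : Prop :=
  TopologicalSpace.MetrizableSpace L ∧
  ∀ (M : Type) [MetricSpace M], ∀ A : Set M, IsClosed A → ∀ e : A ≃ₜ L,
    ∃ U : Set M, IsOpen U ∧ ∃ hAU : A ⊆ U, ∃ r : C(U, L),
      ∀ (a : M) (ha : a ∈ A), r ⟨a, hAU ha⟩ = e ⟨a, ha⟩

/-- `L-Ind_{b+} X`: the least dimension value `d` such that some open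
neighbourhood of `b` has closure of `L-Ind` at most `d`. -/
def LIndPlus (L : Type) [TopologicalSpace L] {X : Type} [TopologicalSpace X] (b : X) : Dim :=
  sInf {d : Dim | ∃ U : Set X, IsOpen U ∧ b ∈ U ∧ LInd L (↥(closure U)) ≤ d}

/-- The set `K(X) = {b ∈ X : L-Ind_{b+} X = L-Ind X}`. -/
def LKset (L : Type) [TopologicalSpace L] (X : Type) [TopologicalSpace X] : Set X :=
  {b | LIndPlus L b = LInd L X}

/-- The weight of a topological space: the least cardinality of a basis. -/
def tWeight (X : Type) [TopologicalSpace X] : Cardinal :=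
  sInf {c | ∃ B : Set (Set X), TopologicalSpace.IsTopologicalBasis B ∧ #B = c}

/-- The family `𝒮_X` of all subsets of `X` that are finite or homeomorphic to the
one-point compactification `A_{ℵ₀}` of a countably infinite discrete space. -/
def SFam (X : Type) [TopologicalSpace X] : Set (Set X) :=
  {S | S.Finite ∨ Nonempty (↥S ≃ₜ OnePoint ℕ)}

/-- The relation generating the quotient `N` in the `Z(X,Y)` construction:
each set `{μ} × {x} × Y` is collapsed to a point. -/
def ZRel (ι X Y : Type) : (OnePoint ι × X × Y) → (OnePoint ι × X × Y) → Prop :=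
  fun p q => p.1 = OnePoint.infty ∧ q.1 = OnePoint.infty ∧ p.2.1 = q.2.1

/-- The quotient space `N` of `A_𝔪 × X × Y`. -/
abbrev ZQuot (ι X Y : Type) [TopologicalSpace ι] [TopologicalSpace X] [TopologicalSpace Y] :
    Type :=
  Quot (ZRel ι X Y)

/-- The subset `Z(X,Y) = ⋃_{α ∈ A_𝔪} H(α)` of `N`:  `H(μ) = π₁({μ} × X × Y)` and
`H(α) = π₁({α} × φ(α) × Y)` for `α ≠ μ`. -/
def ZSet (ι X Y : Type) [TopologicalSpace ι] [TopologicalSpace X] [TopologicalSpace Y]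
    (φ : ι → Set X) : Set (ZQuot ι X Y) :=
  {z | ∃ p : OnePoint ι × X × Y, Quot.mk (ZRel ι X Y) p = z ∧
        (p.1 = OnePoint.infty ∨ ∃ i : ι, p.1 = (i : OnePoint ι) ∧ p.2.1 ∈ φ i)}

/-- The space `Z(X,Y)` (for the data `ι`, `φ`), with the subspace topology. -/
abbrev ZSpace (ι X Y : Type) [TopologicalSpace ι] [TopologicalSpace X] [TopologicalSpace Y]
    (φ : ι → Set X) : Type :=
  ↥(ZSet ι X Y φ)

/-- The subset `H(μ)` of `Z(X,Y)`. -/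
def ZHmu (ι X Y : Type) [TopologicalSpace ι] [TopologicalSpace X] [TopologicalSpace Y]
    (φ : ι → Set X) : Set (ZSpace ι X Y φ) :=
  {z | ∃ (x : X) (y : Y), (z : ZQuot ι X Y) = Quot.mk (ZRel ι X Y) (OnePoint.infty, x, y)}

/-- The projection `π_X : N → X`, `π₁(α,x,y) ↦ x`. -/
def ZQuotProjX {ι X Y : Type} [TopologicalSpace ι] [TopologicalSpace X] [TopologicalSpace Y] :
    ZQuot ι X Y → X :=
  Quot.lift (fun p => p.2.1) (fun _ _ h => h.2.2)

/-- The projection `π_X : Z(X,Y) → X`. -/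
def ZProjX {ι X Y : Type} [TopologicalSpace ι] [TopologicalSpace X] [TopologicalSpace Y]
    (φ : ι → Set X) : ZSpace ι X Y φ → X :=
  fun z => ZQuotProjX (z : ZQuot ι X Y)

/-- The cardinality requirements on the index set `ι` (of cardinality `𝔪`) in the
`Z(X,Y)` construction: `𝔪 ≥ max {ℵ₀, (wX)⁺, (wY)⁺, card 𝒮_X}`. -/
def ZCardOK (X Y ι : Type) [TopologicalSpace X] [TopologicalSpace Y] : Prop :=
  ℵ₀ ≤ #ι ∧ tWeight X < #ι ∧ tWeight Y < #ι ∧ #(SFam X) ≤ #ι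

/-- The requirements on `φ : A_𝔪 \ {μ} → 𝒮_X`: it takes values in `𝒮_X` and every
fibre has cardinality `𝔪`. -/
def ZPhiOK {X ι : Type} [TopologicalSpace X] (φ : ι → Set X) : Prop :=
  (∀ i, φ i ∈ SFam X) ∧ ∀ S ∈ SFam X, #(↥(φ ⁻¹' {S})) = #ι


/-! ## Basic unfolding lemmas -/

abbrev Esp (k : ℕ) : Type := EuclideanSpace ℝ (Fin k)

abbrev Sph (k : ℕ) : Type := ↥(Metric.sphere (0 : EuclideanSpace ℝ (Fin k)) 1)

theorem KIndLE_iff {m : ℕ} (K : Finset (Fin m) → Prop) (X : Type) [tX : TopologicalSpace X]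
    (α : Ordinal.{0}) : KIndLE K X α ↔
    ∀ F : Fin m → Set X, (∀ i, IsClosed (F i)) → IsKTuple K F →
      ∃ U : Fin m → Set X, (∀ i, IsOpen (U i)) ∧ IsKTuple K U ∧ (∀ i, F i ⊆ U i) ∧
        ((⋃ i, U i)ᶜ = (∅ : Set X) ∨
          ∃ β < α, KIndLE K (↥((⋃ i, U i)ᶜ)) β) := by
  unfold KIndLE KIndLeAux
  rw [WellFounded.fix_eq]
  constructor
  · intro h F hF hK
    obtain ⟨U, h1, h2, h3, h4⟩ := h F hF hK
    refine ⟨U, h1, h2, h3, ?_⟩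
    rcases h4 with h4 | ⟨β, hβ⟩
    · exact Or.inl h4
    · exact Or.inr ⟨β.1, β.2, hβ⟩
  · intro h F hF hK
    obtain ⟨U, h1, h2, h3, h4⟩ := h F hF hK
    refine ⟨U, h1, h2, h3, ?_⟩
    rcases h4 with h4 | ⟨β, hβ, hβ'⟩
    · exact Or.inl h4
    · exact Or.inr ⟨⟨β, hβ⟩, hβ'⟩

theorem LIndLE_iff (L : Type) [TopologicalSpace L] (X : Type) [tX : TopologicalSpace X]
    (α : Ordinal.{0}) : LIndLE L X α ↔
    ∀ F : Set X, IsClosed F → ∀ f : C(F, L),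
      ∃ U : Set X, IsOpen U ∧ ∃ hFU : F ⊆ U,
        (∃ g : C(U, L), ∀ (x : X) (hx : x ∈ F), g ⟨x, hFU hx⟩ = f ⟨x, hx⟩) ∧
        (Uᶜ = (∅ : Set X) ∨ ∃ β < α, LIndLE L (↥(Uᶜ)) β) := by
  unfold LIndLE LIndLeAux
  rw [WellFounded.fix_eq]
  constructor
  · intro h F hF f
    obtain ⟨U, h1, h2, h3, h4⟩ := h F hF f
    refine ⟨U, h1, h2, h3, ?_⟩
    rcases h4 with h4 | ⟨β, hβ⟩
    · exact Or.inl h4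
    · exact Or.inr ⟨β.1, β.2, hβ⟩
  · intro h F hF f
    obtain ⟨U, h1, h2, h3, h4⟩ := h F hF f
    refine ⟨U, h1, h2, h3, ?_⟩
    rcases h4 with h4 | ⟨β, hβ, hβ'⟩
    · exact Or.inl h4
    · exact Or.inr ⟨⟨β, hβ⟩, hβ'⟩

theorem KIndLE_mono {m : ℕ} {K : Finset (Fin m) → Prop} {X : Type} [TopologicalSpace X]
    {α β : Ordinal.{0}} (hab : α ≤ β) (h : KIndLE K X α) : KIndLE K X β := by
  rw [KIndLE_iff] at h ⊢
  intro F hF hK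
  obtain ⟨U, h1, h2, h3, h4⟩ := h F hF hK
  refine ⟨U, h1, h2, h3, ?_⟩
  rcases h4 with h4 | ⟨γ, hγ, hγ'⟩
  · exact Or.inl h4
  · exact Or.inr ⟨γ, hγ.trans_le hab, hγ'⟩

theorem LIndLE_mono {L : Type} [TopologicalSpace L] {X : Type} [TopologicalSpace X]
    {α β : Ordinal.{0}} (hab : α ≤ β) (h : LIndLE L X α) : LIndLE L X β := by
  rw [LIndLE_iff] at h ⊢
  intro F hF f
  obtain ⟨U, h1, h2, h3, h4⟩ := h F hF f
  refine ⟨U, h1, h2, h3, ?_⟩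
  rcases h4 with h4 | ⟨γ, hγ, hγ'⟩
  · exact Or.inl h4
  · exact Or.inr ⟨γ, hγ.trans_le hab, hγ'⟩

/-- `L-Ind` is monotone under closed embeddings. -/
theorem LIndLE_closedEmb {L : Type} [TopologicalSpace L] (α : Ordinal.{0}) :
    ∀ {X Y : Type} [TopologicalSpace X] [TopologicalSpace Y] (e : Y → X),
    IsClosedEmbedding e → LIndLE L X α → LIndLE L Y α := by
  induction α using WellFoundedLT.induction with
  | ind α ih =>
  intro X Y _ _ e he h
  rw [LIndLE_iff] at h ⊢
  intro F hF f
  let eF : F ≃ₜ (e '' F) := he.isEmbedding.homeomorphImage F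
  obtain ⟨U, h1, h2, ⟨g, hg⟩, h4⟩ := h (e '' F) (he.isClosedMap F hF)
    (f.comp ⟨eF.symm, eF.symm.continuous⟩)
  refine ⟨e ⁻¹' U, h1.preimage he.continuous, fun x hx => h2 ⟨x, hx, rfl⟩,
    ⟨g.comp ⟨fun x => ⟨e x.1, x.2⟩, by fun_prop (disch := exact he.continuous)⟩, ?_⟩, ?_⟩
  · intro x hx
    have := hg (e x) ⟨x, hx, rfl⟩
    simp only [ContinuousMap.comp_apply, ContinuousMap.coe_mk] at this ⊢
    rw [this]
    congr 1
    rw [Homeomorph.symm_apply_eq]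
    rfl
  · rcases h4 with h4 | ⟨β, hβ, hβ'⟩
    · left
      rw [← preimage_compl, h4, preimage_empty]
    · right
      refine ⟨β, hβ, ih β hβ (fun x : ↥((e ⁻¹' U)ᶜ) => (⟨e x.1, x.2⟩ : ↥(Uᶜ))) ?_ hβ'⟩
      have := he.comp (h1.preimage he.continuous).isClosed_compl.isClosedEmbedding_subtypeVal
      refine ⟨⟨?_, ?_⟩, ?_⟩
      · rw [isInducing_iff]
        have h5 := this.isInducing
        rw [isInducing_iff] at h5
        rw [h5, instTopologicalSpaceSubtype, induced_compose]
        rfl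
      · intro a b hab
        exact this.injective (congrArg Subtype.val hab)
      · have h5 := this.isClosed_range
        convert h5.preimage (continuous_subtype_val (p := fun x => x ∈ Uᶜ)) using 1
        ext z
        constructor
        · rintro ⟨a, rfl⟩; exact ⟨a, rfl⟩
        · rintro ⟨a, ha⟩; exact ⟨a, Subtype.ext ha⟩

/-- Being a `∂Δ^k`-tuple. -/
theorem isKTuple_b {k : ℕ} {X : Type} {A : Fin (k + 1) → Set X} :
    IsKTuple (bComplex k) A ↔ ∀ x, ∃ i, x ∉ A i := by
  constructor
  · intro h x
    by_contra! hx
    exact h Finset.univ Finset.univ_nonempty ⟨x, by simpa using hx⟩ rfl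
  · rintro h I hI ⟨x, hx⟩ rfl
    obtain ⟨i, hi⟩ := h x
    simp at hx
    exact hi (hx i)

/-- Closed tuples with empty intersection swell to open ones. -/
theorem swell {X : Type} [TopologicalSpace X] [NormalSpace X] {ι : Type} [Finite ι]
    (F : ι → Set X) (hF : ∀ i, IsClosed (F i)) (hK : ∀ x, ∃ i, x ∉ F i) :
    ∃ U : ι → Set X, (∀ i, IsOpen (U i)) ∧ (∀ i, F i ⊆ U i) ∧ ∀ x, ∃ i, x ∉ U i := by
  obtain ⟨v, hv, hvc, hvu⟩ := exists_subset_iUnion_closed_subset (s := (univ : Set X))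
    (u := fun i => (F i)ᶜ) isClosed_univ (fun i => (hF i).isOpen_compl)
    (fun x _ => toFinite _) (fun x _ => by
      obtain ⟨i, hi⟩ := hK x
      exact mem_iUnion.2 ⟨i, hi⟩)
  refine ⟨fun i => (v i)ᶜ, fun i => (hvc i).isOpen_compl, fun i x hx hxv => hvu i hxv hx,
    fun x => ?_⟩
  obtain ⟨i, hi⟩ := mem_iUnion.1 (hv (mem_univ x))
  exact ⟨i, fun h => h hi⟩

/-- The open form of `∂Δ^k`-dim, counted by the number `q` of tuples. -/
def KDimO (k : ℕ) (X : Type) [TopologicalSpace X] (q : ℕ) : Prop :=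
  ∀ F : Fin q → Fin (k + 1) → Set X, (∀ j i, IsClosed (F j i)) → (∀ j x, ∃ i, x ∉ F j i) →
    ∃ U : Fin q → Fin (k + 1) → Set X, (∀ j i, IsOpen (U j i)) ∧ (∀ j i, F j i ⊆ U j i) ∧
      (∀ j x, ∃ i, x ∉ U j i) ∧ ∀ x, ∃ j i, x ∈ U j i

theorem KDimLE_iff (k : ℕ) (X : Type) [TopologicalSpace X] (n : ℕ) :
    KDimLE (bComplex k) X n ↔ KDimO k X (n + 1) := by
  unfold KDimLE KDimO KNbhd
  simp only [isKTuple_b]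
  refine forall_congr' fun F => forall_congr' fun _ => forall_congr' fun _ =>
    exists_congr fun U => ?_
  rw [eq_empty_iff_forall_notMem]
  simp only [mem_iInter, mem_compl_iff, mem_iUnion, not_forall, not_not]
  constructor
  · rintro ⟨h, h2⟩
    exact ⟨fun j => (h j).1, fun j => (h j).2.2, fun j => (h j).2.1, h2⟩
  · rintro ⟨h1, h2, h3, h4⟩
    exact ⟨fun j => ⟨h1 j, h3 j, h2 j⟩, h4⟩

theorem KDimO.closed {k : ℕ} {X : Type} [TopologicalSpace X] [NormalSpace X] {q : ℕ}
    (h : KDimO k X q) (F : Fin q → Fin (k + 1) → Set X) (hF : ∀ j i, IsClosed (F j i))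
    (hK : ∀ j x, ∃ i, x ∉ F j i) :
    ∃ D : Fin q → Fin (k + 1) → Set X, (∀ j i, IsClosed (D j i)) ∧ (∀ j i, F j i ⊆ D j i) ∧
      (∀ j x, ∃ i, x ∉ D j i) ∧ ∀ x, ∃ j i, x ∈ D j i := by
  obtain ⟨U, hU, hFU, hUK, hcov⟩ := h F hF hK
  obtain ⟨v, hv, hvc, hvu⟩ := exists_subset_iUnion_closed_subset (s := (univ : Set X))
    (u := fun p : Fin q × Fin (k + 1) => U p.1 p.2) isClosed_univ (fun p => hU _ _)
    (fun x _ => toFinite _) (fun x _ => by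
      obtain ⟨j, i, hi⟩ := hcov x
      exact mem_iUnion.2 ⟨(j, i), hi⟩)
  refine ⟨fun j i => F j i ∪ v (j, i), fun j i => (hF j i).union (hvc _),
    fun j i => subset_union_left, fun j x => ?_, fun x => ?_⟩
  · obtain ⟨i, hi⟩ := hUK j x
    refine ⟨i, ?_⟩
    rintro (h | h)
    · exact hi (hFU _ _ h)
    · exact hi (hvu _ h)
  · obtain ⟨⟨j, i⟩, hi⟩ := mem_iUnion.1 (hv (mem_univ x))
    exact ⟨j, i, Or.inr hi⟩

theorem KDimO.closedEmb {k : ℕ} {X Y : Type} [TopologicalSpace X] [TopologicalSpace Y]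
    {q : ℕ} (h : KDimO k X q) (e : Y → X) (he : IsClosedEmbedding e) : KDimO k Y q := by
  intro F hF hK
  obtain ⟨U, hU, hFU, hUK, hcov⟩ := h (fun j i => e '' F j i)
    (fun j i => he.isClosedMap _ (hF j i)) (fun j x => by
      by_contra! hx
      obtain ⟨y, hy, rfl⟩ := hx 0
      obtain ⟨i, hi⟩ := hK j y
      obtain ⟨y', hy', h'⟩ := hx i
      exact hi (he.injective h' ▸ hy'))
  refine ⟨fun j i => e ⁻¹' U j i, fun j i => (hU j i).preimage he.continuous,
    fun j i y hy => hFU j i ⟨y, hy, rfl⟩, fun j y => hUK j (e y), fun y => hcov (e y)⟩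

/-- `K-dim ≤ K-Ind`. -/
theorem KIndLE.kdim {k : ℕ} (n : ℕ) : ∀ {X : Type} [TopologicalSpace X] [CompactSpace X]
    [T2Space X], KIndLE (bComplex k) X (n : Ordinal.{0}) → KDimO k X (n + 1) := by
  induction n with
  | zero =>
    intro X _ _ _ h F hF hK
    rw [KIndLE_iff] at h
    obtain ⟨U, h1, h2, h3, h4⟩ := h (F 0) (hF 0) (isKTuple_b.2 (hK 0))
    have h5 : (⋃ i, U i)ᶜ = ∅ := by
      rcases h4 with h4 | ⟨β, hβ, _⟩
      · exact h4
      · simp at hβ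
    refine ⟨fun _ => U, fun _ => h1, fun j => ?_, fun _ => isKTuple_b.1 h2, fun x => ⟨0, ?_⟩⟩
    · obtain rfl : j = 0 := by ext; omega
      exact h3
    · rw [compl_empty_iff] at h5
      exact mem_iUnion.1 (h5 ▸ mem_univ x)
  | succ n ih =>
    intro X _ _ _ h F hF hK
    rw [KIndLE_iff] at h
    obtain ⟨U, h1, h2, h3, h4⟩ := h (F 0) (hF 0) (isKTuple_b.2 (hK 0))
    set P := (⋃ i, U i)ᶜ with hP
    have hPc : IsClosed P := (isOpen_iUnion h1).isClosed_compl
    have hPe := hPc.isClosedEmbedding_subtypeVal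
    have : CompactSpace P := isCompact_iff_compactSpace.1 hPc.isCompact
    have hdim : KDimO k P (n + 1) := by
      rcases h4 with h4 | ⟨β, hβ, hβ'⟩
      · intro G hG hGK
        refine ⟨fun _ _ => ∅, fun _ _ => isOpen_empty, fun j i x => ?_, fun j x => ?_,
          fun x => ?_⟩
        all_goals exact absurd (h4 ▸ x.2 : x.1 ∈ (∅ : Set X)) (notMem_empty _)
      · apply ih
        apply KIndLE_mono _ hβ'
        rw [Nat.cast_succ] at hβ
        exact Order.lt_add_one_iff.1 hβ
    obtain ⟨D, hD, hFD, hDK, hDcov⟩ := hdim.closed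
      (fun j i => Subtype.val ⁻¹' F j.succ i)
      (fun j i => (hF _ _).preimage continuous_subtype_val) (fun j x => hK _ x.1)
    have key : ∀ j : Fin (n + 1), ∃ W : Fin (k + 1) → Set X, (∀ i, IsOpen (W i)) ∧
        (∀ i, (F j.succ i ∪ Subtype.val '' D j i) ⊆ W i) ∧ ∀ x, ∃ i, x ∉ W i := by
      intro j
      refine swell _ (fun i => (hF _ _).union (hPe.isClosedMap _ (hD j i))) fun x => ?_
      by_cases hx : x ∈ P
      · obtain ⟨i, hi⟩ := hDK j ⟨x, hx⟩
        refine ⟨i, ?_⟩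
        rintro (h | ⟨y, hy, rfl⟩)
        · exact hi (hFD j i h)
        · exact hi hy
      · obtain ⟨i, hi⟩ := hK j.succ x
        refine ⟨i, ?_⟩
        rintro (h | ⟨y, hy, rfl⟩)
        · exact hi h
        · exact hx y.2
    choose W hW hFW hWK using key
    refine ⟨Fin.cons U W, fun j => ?_, fun j => ?_, fun j => ?_, fun x => ?_⟩
    · refine Fin.cases ?_ (fun j => ?_) j
      · simpa using h1
      · simpa using hW j
    · refine Fin.cases ?_ (fun j => ?_) j
      · simpa using h3
      · simpa using fun i => subset_union_left.trans (hFW j i)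
    · refine Fin.cases ?_ (fun j => ?_) j
      · simpa using isKTuple_b.1 h2
      · simpa using hWK j
    · by_cases hx : x ∈ P
      · obtain ⟨j, i, hi⟩ := hDcov ⟨x, hx⟩
        exact ⟨j.succ, i, by simpa using hFW j i (Or.inr ⟨_, hi, rfl⟩)⟩
      · rw [hP, notMem_compl_iff, mem_iUnion] at hx
        exact ⟨0, by simpa using hx⟩

/-! ## From sphere partitions to `K`-partitions -/

/-- Coordinates with an additional zero coordinate. -/
def hatv {k : ℕ} (v : Esp k) : Fin (k + 1) → ℝ := Fin.cons 0 (fun i => v i)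

theorem continuous_hatv {k : ℕ} (i : Fin (k + 1)) : Continuous fun v : Esp k => hatv v i := by
  refine Fin.cases ?_ (fun i => ?_) i
  · simpa [hatv] using continuous_const
  · simp only [hatv, Fin.cons_succ]
    fun_prop

/-- The open star of the `i`-th vertex. -/
def starv {k : ℕ} (i : Fin (k + 1)) : Set (Esp k) := {v | ∃ j, hatv v j < hatv v i}

theorem isOpen_starv {k : ℕ} (i : Fin (k + 1)) : IsOpen (starv (k := k) i) := by
  have : starv (k := k) i = ⋃ j, {v | hatv v j < hatv v i} := by
    ext v; simp [starv]
  rw [this]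
  exact isOpen_iUnion fun j => isOpen_lt (continuous_hatv j) (continuous_hatv i)

theorem starv_empty {k : ℕ} (v : Esp k) : ∃ i, v ∉ starv i := by
  obtain ⟨i, hi⟩ := Finite.exists_min (hatv v)
  exact ⟨i, fun ⟨j, hj⟩ => absurd (hi j) (not_le.2 hj)⟩

theorem starv_cover {k : ℕ} (v : Esp k) (hv : v ≠ 0) : ∃ i, v ∈ starv i := by
  by_contra! h
  apply hv
  ext i
  have h1 : ¬ hatv v 0 < hatv v i.succ := fun hh => h _ ⟨_, hh⟩
  have h2 : ¬ hatv v i.succ < hatv v 0 := fun hh => h _ ⟨_, hh⟩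
  simp [hatv] at h1 h2 ⊢
  linarith

theorem LIndLE.toK {k : ℕ} (α : Ordinal.{0}) : ∀ {X : Type} [TopologicalSpace X]
    [CompactSpace X] [T2Space X], LIndLE (Sph k) X α → KIndLE (bComplex k) X α := by
  induction α using WellFoundedLT.induction with
  | ind α ih =>
  intro X _ _ _ h
  rw [LIndLE_iff] at h
  rw [KIndLE_iff]
  intro F hF hK
  rw [isKTuple_b] at hK
  obtain ⟨W, hW, hFW, hWK⟩ := swell F hF hK
  have hur : ∀ i, ∃ t : C(X, ℝ), EqOn t 0 (W i)ᶜ ∧ EqOn t 1 (F i) ∧ ∀ x, t x ∈ Icc (0 : ℝ) 1 :=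
    fun i => exists_continuous_zero_one_of_isClosed (hW i).isClosed_compl (hF i)
      (disjoint_left.2 fun x hx hx' => hx (hFW i hx'))
  choose t ht0 ht1 ht using hur
  let v : X → Esp k := fun x => WithLp.toLp 2 fun i : Fin k => t i.succ x - t 0 x
  have hvc : Continuous v := by
    apply (PiLp.continuous_toLp 2 _).comp
    fun_prop
  have hhat : ∀ x i, hatv (v x) i = t i x - t 0 x := by
    intro x i
    refine Fin.cases ?_ (fun i => ?_) i
    · simp [hatv]
    · simp [hatv, v]
  let G : Set X := ⋃ i, F i
  have hG : IsClosed G := isClosed_iUnion_of_finite hF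
  have hst : ∀ x i, x ∈ F i → v x ∈ starv i := by
    intro x i hx
    obtain ⟨j, hj⟩ := hWK x
    refine ⟨j, ?_⟩
    rw [hhat, hhat, ht0 j hj, ht1 i hx]
    simp
  have hne : ∀ x ∈ G, v x ≠ 0 := by
    intro x hx h0
    obtain ⟨i, hi⟩ := mem_iUnion.1 hx
    obtain ⟨j, hj⟩ := hst x i hi
    rw [h0] at hj
    have : ∀ j, hatv (0 : Esp k) j = 0 := by
      intro j
      refine Fin.cases ?_ (fun i => ?_) j <;> simp [hatv]
    rw [this, this] at hj
    exact lt_irrefl _ hj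
  let f : C(G, Sph k) := ⟨fun x => ⟨‖v x‖⁻¹ • v x, by
      rw [mem_sphere_zero_iff_norm, norm_smul, norm_inv, norm_norm,
        inv_mul_cancel₀ (norm_ne_zero_iff.2 (hne x x.2))]⟩, by
      refine Continuous.subtype_mk ?_ _
      have hc : Continuous fun x : G => v x := hvc.comp continuous_subtype_val
      exact (hc.norm.inv₀ fun x => norm_ne_zero_iff.2 (hne x x.2)).smul hc⟩
  obtain ⟨U, hU, hGU, ⟨g, hg⟩, h4⟩ := h G hG f
  have hUn : (⋃ i, {x : X | ∃ hx : x ∈ U, (g ⟨x, hx⟩ : Esp k) ∈ starv i}) = U := by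
    ext x
    simp only [mem_iUnion, mem_setOf_eq]
    constructor
    · rintro ⟨_, hx, _⟩; exact hx
    · intro hx
      obtain ⟨i, hi⟩ := starv_cover (g ⟨x, hx⟩ : Esp k) (by
        intro h0
        have := (g ⟨x, hx⟩).2
        rw [h0] at this
        simp at this)
      exact ⟨i, hx, hi⟩
  refine ⟨fun i => {x | ∃ hx : x ∈ U, (g ⟨x, hx⟩ : Esp k) ∈ starv i}, fun i => ?_, ?_, ?_, ?_⟩
  · have h1 : IsOpen ((fun x : U => (g x : Esp k)) ⁻¹' starv i) :=
      (isOpen_starv i).preimage (by fun_prop)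
    convert hU.isOpenEmbedding_subtypeVal.isOpenMap _ h1 using 1
    ext x
    simp
  · rw [isKTuple_b]
    intro x
    by_cases hx : x ∈ U
    · obtain ⟨i, hi⟩ := starv_empty (g ⟨x, hx⟩ : Esp k)
      exact ⟨i, fun ⟨_, h⟩ => hi h⟩
    · exact ⟨0, fun ⟨h, _⟩ => hx h⟩
  · intro i x hx
    have hxG : x ∈ G := mem_iUnion.2 ⟨i, hx⟩
    refine ⟨hGU hxG, ?_⟩
    rw [hg x hxG]
    obtain ⟨j, hj⟩ := hst x i hx
    refine ⟨j, ?_⟩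
    have hsc : ∀ i, hatv (‖v x‖⁻¹ • v x) i = ‖v x‖⁻¹ * hatv (v x) i := by
      intro i
      refine Fin.cases ?_ (fun i => ?_) i <;> simp [hatv]
    change hatv (‖v x‖⁻¹ • v x) j < hatv (‖v x‖⁻¹ • v x) i
    rw [hsc, hsc]
    exact mul_lt_mul_of_pos_left hj (inv_pos.2 (norm_pos_iff.2 (hne x hxG)))
  · rw [hUn]
    rcases h4 with h4 | ⟨β, hβ, hβ'⟩
    · exact Or.inl h4
    · have : CompactSpace (↥Uᶜ) := isCompact_iff_compactSpace.1 hU.isClosed_compl.isCompact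
      exact Or.inr ⟨β, hβ, ih β hβ hβ'⟩

/-! ## Covering dimension from `K`-dim -/

/-- Shrinking of an open cover with `n * k + 1` members. -/
theorem shrinkOne {k n : ℕ} {X : Type} [TopologicalSpace X] [NormalSpace X]
    (h : KDimO k X n) (U : Option (Fin n × Fin k) → Set X) (hU : ∀ l, IsOpen (U l))
    (hcov : ∀ x, ∃ l, x ∈ U l) :
    ∃ V : Option (Fin n × Fin k) → Set X, (∀ l, IsOpen (V l)) ∧ (∀ l, V l ⊆ U l) ∧
      (∀ x, ∃ l, x ∈ V l) ∧ ∀ x, ∃ l, x ∉ V l := by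
  obtain ⟨F, hF, hFc, hFO⟩ := exists_subset_iUnion_closed_subset (s := (U none)ᶜ)
    (u := fun j : Fin n => ⋃ i : Fin k, U (some (j, i))) (hU none).isClosed_compl
    (fun j => isOpen_iUnion fun i => hU _)
    (fun x _ => toFinite _) (fun x hx => by
      obtain ⟨l, hl⟩ := hcov x
      rcases l with _ | ⟨j, i⟩
      · exact absurd hl hx
      · exact mem_iUnion.2 ⟨j, mem_iUnion.2 ⟨i, hl⟩⟩)
  obtain ⟨D, hD, hED, hDK, hDcov⟩ := h.closed
    (fun j => (Fin.cons (F j) fun i : Fin k => (U (some (j, i)))ᶜ : Fin (k + 1) → Set X))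
    (fun j i => by
      refine Fin.cases ?_ (fun i => ?_) i
      · simpa using hFc j
      · simpa using hU _)
    (fun j x => by
      by_cases hx : x ∈ F j
      · obtain ⟨i, hi⟩ := mem_iUnion.1 (hFO j hx)
        exact ⟨i.succ, by simpa using hi⟩
      · exact ⟨0, by simpa using hx⟩)
  refine ⟨fun l => Option.elim l (⋂ j, (D j 0)ᶜ) fun p => (D p.1 p.2.succ)ᶜ, fun l => ?_,
    fun l => ?_, fun x => ?_, fun x => ?_⟩
  · rcases l with _ | ⟨j, i⟩
    · exact isOpen_iInter_of_finite fun j => (hD _ _).isOpen_compl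
    · exact (hD _ _).isOpen_compl
  · rcases l with _ | ⟨j, i⟩
    · intro x hx
      simp only [Option.elim_none, mem_iInter, mem_compl_iff] at hx
      by_contra hxU
      obtain ⟨j, hj⟩ := mem_iUnion.1 (hF hxU)
      exact hx j (hED j 0 (by simpa using hj))
    · intro x hx
      by_contra hxU
      exact hx (hED j i.succ (by simpa using hxU))
  · by_cases hx : ∃ j, x ∈ D j 0
    · obtain ⟨j, hj⟩ := hx
      obtain ⟨i, hi⟩ := hDK j x
      revert hi
      refine Fin.cases ?_ (fun i => ?_) i
      · exact fun hi => absurd hj hi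
      · exact fun hi => ⟨some (j, i), hi⟩
    · push Not at hx
      exact ⟨none, by simpa using hx⟩
  · obtain ⟨j, i, hi⟩ := hDcov x
    revert hi
    refine Fin.cases ?_ (fun i => ?_) i
    · intro hi
      exact ⟨none, by simpa using ⟨j, hi⟩⟩
    · intro hi
      exact ⟨some (j, i), by simpa using hi⟩

/-- Hemmingsen's argument. -/
theorem covDim_of_KDimO {k n : ℕ} {X : Type} [TopologicalSpace X] [NormalSpace X]
    (h : KDimO k X n) (hkn : 1 ≤ n * k) : CovDimLE X (n * k - 1) := by
  intro ι hι U hU hUcov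
  have := Fintype.ofFinite ι
  have main : ∀ T : Finset (Finset ι), (∀ t ∈ T, t.card = n * k + 1) →
      ∃ V : ι → Set X, (∀ i, IsOpen (V i)) ∧ (∀ i, V i ⊆ U i) ∧ (∀ x, ∃ i, x ∈ V i) ∧
        ∀ t ∈ T, ∀ x, ∃ i ∈ t, x ∉ V i := by
    intro T
    induction T using Finset.induction_on with
    | empty =>
      intro _
      exact ⟨U, hU, fun _ => Subset.rfl, fun x => mem_iUnion.1 (hUcov ▸ mem_univ x), by simp⟩
    | insert t T _ ih =>
      intro hT
      obtain ⟨V, hV, hVU, hVcov, hVT⟩ := ih fun t' ht' => hT t' (Finset.mem_insert_of_mem ht')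
      have hcard := hT t (Finset.mem_insert_self _ _)
      have e : Option (Fin n × Fin k) ≃ t := Fintype.equivOfCardEq (by simp [hcard])
      obtain ⟨W, hW, hWU, hWcov, hWK⟩ := shrinkOne h
        (fun l => Option.elim l (V (e none) ∪ ⋃ i : {i // i ∉ t}, V i) fun p => V (e (some p)))
        (fun l => by
          rcases l with _ | p
          · exact (hV _).union (isOpen_iUnion fun i => hV _)
          · exact hV _)
        (fun x => by
          obtain ⟨i, hi⟩ := hVcov x
          by_cases hit : i ∈ t
          · rcases hl : e.symm ⟨i, hit⟩ with _ | p
            · refine ⟨none, Or.inl ?_⟩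
              rw [← hl]; simpa using hi
            · refine ⟨some p, ?_⟩
              change x ∈ V (e (some p))
              rw [← hl]; simpa using hi
          · exact ⟨none, Or.inr (mem_iUnion.2 ⟨⟨i, hit⟩, hi⟩)⟩)
      refine ⟨fun i => V i ∩ if hi : i ∈ t then W (e.symm ⟨i, hi⟩) else W none,
        fun i => ?_, fun i => inter_subset_left.trans (hVU i), fun x => ?_, ?_⟩
      · refine (hV i).inter ?_
        split_ifs
        · exact hW _
        · exact hW _
      · obtain ⟨l, hl⟩ := hWcov x
        have h1 := hWU l hl
        have h2 : ∀ l, x ∈ W l → x ∈ V (e l) → ∃ i, x ∈ V i ∩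
            if hi : i ∈ t then W (e.symm ⟨i, hi⟩) else W none := by
          intro l hl1 hl2
          refine ⟨e l, hl2, ?_⟩
          rw [dif_pos (e l).2]
          simpa using hl1
        rcases l with _ | p
        · rcases h1 with h1 | h1
          · exact h2 _ hl h1
          · obtain ⟨⟨i, hi⟩, hi'⟩ := mem_iUnion.1 h1
            refine ⟨i, hi', ?_⟩
            rw [dif_neg hi]
            exact hl
        · exact h2 _ hl h1
      · intro t' ht' x
        rcases Finset.mem_insert.1 ht' with rfl | ht'
        · obtain ⟨l, hl⟩ := hWK x
          refine ⟨e l, (e l).2, ?_⟩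
          rintro ⟨_, h2⟩
          rw [dif_pos (e l).2] at h2
          exact hl (by simpa using h2)
        · obtain ⟨i, hi, hi'⟩ := hVT t' ht' x
          exact ⟨i, hi, fun h => hi' h.1⟩
  obtain ⟨V, hV, hVU, hVcov, hVT⟩ := main
    (Finset.univ.filter fun t : Finset ι => t.card = n * k + 1) (by simp)
  refine ⟨V, hV, hVU, eq_univ_of_forall fun x => mem_iUnion.2 (hVcov x), fun x => ?_⟩
  by_contra! hx
  have hx' : n * k + 1 ≤ (Finset.univ.filter fun i => x ∈ V i).card := by
    rw [← Set.ncard_coe_finset]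
    simp only [Finset.coe_filter, Finset.mem_univ, true_and]
    omega
  obtain ⟨t, ht, htc⟩ := Finset.exists_subset_card_eq hx'
  obtain ⟨i, hi, hi'⟩ := hVT t (by simpa using htc) x
  exact hi' (by simpa using ht hi)

lemma pou_supp_prop {T C : Type} [TopologicalSpace C] (ρ : PartitionOfUnity T C univ)
    (x : C) : ∃ i, 0 < ρ i x := by
  exact ρ.exists_pos (mem_univ x)

/-- coloured pieces coming from a partition of unity -/
def pcs {T C : Type} (ρ : T → C → ℝ) (η : ℝ) (σ : Finset T) : Set C :=
  {x | ∀ i ∈ σ, η < ρ i x ∧ ∀ j, j ∉ σ → ρ j x + η < ρ i x}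

lemma pcs_open {T C : Type} [Finite T] [TopologicalSpace C] (ρ : T → C → ℝ)
    (hρ : ∀ i, Continuous (ρ i)) (η : ℝ) (σ : Finset T) : IsOpen (pcs ρ η σ) := by
  have : pcs ρ η σ = ⋂ i ∈ σ, ({x | η < ρ i x} ∩ ⋂ j : T, {x | j ∉ σ → ρ j x + η < ρ i x}) := by
    ext x; simp [pcs]
  rw [this]
  refine isOpen_biInter_finset fun i _ => (isOpen_lt continuous_const (hρ i)).inter ?_
  refine isOpen_iInter_of_finite fun j => ?_
  by_cases hj : j ∈ σ
  · simp [hj]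
  · simpa [hj] using isOpen_lt ((hρ j).add continuous_const) (hρ i)

lemma pcs_anti {T C : Type} (ρ : T → C → ℝ) {η η' : ℝ} (h : η ≤ η') (σ : Finset T) :
    pcs ρ η' σ ⊆ pcs ρ η σ := by
  intro x hx i hi
  refine ⟨h.trans_lt (hx i hi).1, fun j hj => ?_⟩
  have := (hx i hi).2 j hj
  linarith

lemma colour_families {C : Type} [MetricSpace C] [CompactSpace C] {m : ℕ} (h : CovDimLE C m)
    {ε : ℝ} (hε : 0 < ε) : ∃ δ > 0, ∃ V : Fin (m + 1) → Set (Set C),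
      (∀ c, ∀ v ∈ V c, IsOpen v ∧ ∀ x ∈ v, ∀ y ∈ v, dist x y ≤ ε) ∧
      (∀ c, ∀ v ∈ V c, ∀ w ∈ V c, v ≠ w → ∀ x ∈ v, ∀ y ∈ w, δ ≤ dist x y) ∧
      ∀ x, ∃ c, ∃ v ∈ V c, x ∈ v := by
  obtain ⟨t, -, htf, ht⟩ := finite_cover_balls_of_compact (isCompact_univ (X := C))
    (half_pos hε)
  have : Finite t := htf
  have : Fintype t := Fintype.ofFinite t
  obtain ⟨V, hVo, hVs, hVu, hVc⟩ := h t htf (fun i => Metric.ball i.1 (ε / 2))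
    (fun i => Metric.isOpen_ball) (by
      apply eq_univ_of_univ_subset
      refine ht.trans ?_
      rw [biUnion_eq_iUnion])
  obtain ⟨ρ, hρ⟩ := PartitionOfUnity.exists_isSubordinate isClosed_univ V hVo hVu.ge
  have hρV : ∀ i x, 0 < ρ i x → x ∈ V i := fun i x hx =>
    hρ i (subset_tsupport _ (by simpa using hx.ne'))
  have hρc : ∀ i, Continuous (fun x => ρ i x) := fun i => (ρ i).continuous
  let r : t → C → ℝ := fun i x => ρ i x
  have hcov : (univ : Set C) ⊆ ⋃ N : ℕ, ⋃ σ : {σ : Finset t // σ.Nonempty ∧ σ.card ≤ m + 1},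
      pcs r (1 / ((N : ℝ) + 1)) σ.1 := by
    intro x _
    let σ : Finset t := Finset.univ.filter fun i => 0 < ρ i x
    obtain ⟨i0, hi0⟩ := pou_supp_prop ρ x
    have hne : σ.Nonempty := ⟨i0, by simp [σ, hi0]⟩
    have hcard : σ.card ≤ m + 1 := by
      refine le_trans ?_ (hVc x)
      rw [← Set.ncard_coe_finset]
      refine Set.ncard_le_ncard ?_ (Set.toFinite _)
      intro i hi
      exact hρV i x (by simpa [σ] using hi)
    obtain ⟨i1, hi1, hmin⟩ := Finset.exists_min_image σ (fun i => ρ i x) hne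
    obtain ⟨N, hN⟩ := exists_nat_one_div_lt (show 0 < ρ i1 x by simpa [σ] using hi1)
    refine mem_iUnion.2 ⟨N, mem_iUnion.2 ⟨⟨σ, hne, hcard⟩, ?_⟩⟩
    intro i hi
    have h1 := hmin i hi
    refine ⟨hN.trans_le h1, fun j hj => ?_⟩
    have hj0 : ρ j x ≤ 0 := by simpa [σ] using hj
    change ρ j x + _ < ρ i x
    linarith
  obtain ⟨N, hN⟩ := isCompact_univ.elim_directed_cover _
    (fun N => isOpen_iUnion fun σ => pcs_open r hρc _ _) hcov (by
      apply Monotone.directed_le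
      intro a b hab
      refine iUnion_mono fun σ => pcs_anti _ ?_ _
      exact one_div_le_one_div_of_le (by positivity) (by simpa using hab))
  set η : ℝ := 1 / ((N : ℝ) + 1) with hη
  have hη0 : 0 < η := by positivity
  have huc : UniformContinuous (fun x : C => fun i : t => ρ i x) :=
    CompactSpace.uniformContinuous_of_continuous (continuous_pi hρc)
  obtain ⟨δ, hδ, hδ'⟩ := Metric.uniformContinuous_iff.1 huc (η / 2) (half_pos hη0)
  refine ⟨δ, hδ, fun c => {v | ∃ σ : Finset t, σ.card = c.1 + 1 ∧ v = pcs r η σ}, ?_, ?_, ?_⟩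
  · rintro c v ⟨σ, hσ, rfl⟩
    refine ⟨pcs_open r hρc _ _, fun x hx y hy => ?_⟩
    obtain ⟨i, hi⟩ : σ.Nonempty := Finset.card_pos.1 (by omega)
    have hx' := hVs i (hρV i x (hη0.trans (hx i hi).1))
    have hy' := hVs i (hρV i y (hη0.trans (hy i hi).1))
    have := dist_triangle_right x y i.1
    rw [Metric.mem_ball] at hx' hy'
    linarith
  · rintro c v ⟨σ, hσ, rfl⟩ w ⟨τ, hτ, rfl⟩ hne x hx y hy
    by_contra hlt
    push Not at hlt
    have hne' : σ ≠ τ := fun h => hne (by rw [h])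
    obtain ⟨i, hi, hi'⟩ : ∃ i ∈ σ, i ∉ τ := by
      by_contra hcon
      push Not at hcon
      exact hne' (Finset.eq_of_subset_of_card_le hcon (by omega))
    obtain ⟨j, hj, hj'⟩ : ∃ i ∈ τ, i ∉ σ := by
      by_contra hcon
      push Not at hcon
      exact hne' (Finset.eq_of_subset_of_card_le hcon (by omega)).symm
    have hd := hδ' hlt
    have h1 := (hx i hi).2 j hj'
    have h2 := (hy j hj).2 i hi'
    have h3 := (dist_le_pi_dist (fun i : t => ρ i x) (fun i : t => ρ i y) i).trans_lt hd
    have h4 := (dist_le_pi_dist (fun i : t => ρ i x) (fun i : t => ρ i y) j).trans_lt hd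
    rw [Real.dist_eq, abs_lt] at h3 h4
    simp only [r] at h1 h2
    linarith [h3.1, h3.2, h4.1, h4.2]
  · intro x
    obtain ⟨σ, hσ⟩ := mem_iUnion.1 (hN (mem_univ x))
    have := Finset.card_pos.2 σ.2.1
    have := σ.2.2
    exact ⟨⟨σ.1.card - 1, by omega⟩, _, ⟨σ.1, by simp; omega, rfl⟩, hσ⟩

/-- `N` is avoided by zero sets of suitable separating functions -/
def SepSet {X : Type} [TopologicalSpace X] (N : Set X) : Prop :=
  ∀ A B : Set X, IsClosed A → IsClosed B → Disjoint A B →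
    ∃ h : C(X, ℝ), (∀ x ∈ A, h x < 0) ∧ (∀ x ∈ B, 0 < h x) ∧ ∀ x ∈ N, h x ≠ 0

/-- `X` is covered by `q` separable sets -/
def QD (X : Type) [TopologicalSpace X] (q : ℕ) : Prop :=
  ∃ N : Fin q → Set X, (∀ c, SepSet (N c)) ∧ ∀ x, ∃ c, x ∈ N c

lemma exists_cozero {C : Type} [MetricSpace C] {U : Set C} (hU : IsOpen U) :
    ∃ f : C(C, ℝ), (∀ x, 0 ≤ f x) ∧ ∀ x, 0 < f x ↔ x ∈ U := by
  by_cases hne : Uᶜ.Nonempty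
  · refine ⟨⟨fun x => Metric.infDist x Uᶜ, Metric.continuous_infDist_pt _⟩,
      fun x => Metric.infDist_nonneg, fun x => ?_⟩
    have := hU.isClosed_compl.notMem_iff_infDist_pos hne (x := x)
    simpa using this.symm
  · rw [not_nonempty_iff_eq_empty, compl_empty_iff] at hne
    exact ⟨⟨fun _ => 1, continuous_const⟩, fun x => by simp, fun x => by simp [hne]⟩

/-- one step in the separation process -/
def sepStep {C : Type} [MetricSpace C] (e : ℝ) (V : Set (Set C)) (P : Set C × Set C) :
    Set C × Set C :=
  (P.1 ∪ ⋃₀ {v | v ∈ V ∧ ∃ x ∈ v, ∃ a ∈ P.1, dist x a < e / 3},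
   P.2 ∪ ⋃₀ {v | v ∈ V ∧ ¬ ∃ x ∈ v, ∃ a ∈ P.1, dist x a < e / 3})

lemma sepSet_of_seq {C : Type} [MetricSpace C] [CompactSpace C] (e : ℕ → ℝ) (he : ∀ t, 0 < e t)
    (he' : ∀ t, e (t + 1) ≤ e t / 3) (V : ℕ → Set (Set C))
    (hV : ∀ t, ∀ v ∈ V t, IsOpen v ∧ ∀ x ∈ v, ∀ y ∈ v, dist x y ≤ e t / 3)
    (hV' : ∀ t, ∀ v ∈ V t, ∀ w ∈ V t, v ≠ w → ∀ x ∈ v, ∀ y ∈ w, e (t + 1) ≤ dist x y) :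
    SepSet {x | ∃ᶠ t in Filter.atTop, ∃ v ∈ V t, x ∈ v} := by
  intro A B hA hB hAB
  obtain ⟨δ, hδ, hd⟩ := hAB.exists_thickenings hA.isCompact hB
  have hle : ∀ t, e t ≤ e 0 * (1 / 3 : ℝ) ^ t := by
    intro t
    induction t with
    | zero => simp
    | succ t ih =>
      have := he' t
      rw [pow_succ]; linarith
  obtain ⟨t0, ht0⟩ : ∃ t0, e t0 ≤ δ / 3 := by
    have hl : Filter.Tendsto (fun t : ℕ => e 0 * (1 / 3 : ℝ) ^ t) Filter.atTop (𝓝 (e 0 * 0)) :=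
      (tendsto_pow_atTop_nhds_zero_of_lt_one (by norm_num) (by norm_num)).const_mul _
    rw [mul_zero] at hl
    obtain ⟨t0, ht0⟩ := (hl.eventually_lt_const (show (0 : ℝ) < δ / 3 by linarith)).exists
    exact ⟨t0, (hle t0).trans ht0.le⟩
  let P : ℕ → Set C × Set C := fun s => Nat.rec
    (Metric.thickening (δ / 3) A, Metric.thickening (δ / 3) B)
    (fun s p => sepStep (e (t0 + s)) (V (t0 + s)) p) s
  have hPs : ∀ s, P (s + 1) = sepStep (e (t0 + s)) (V (t0 + s)) (P s) := fun s => rfl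
  have hinv : ∀ s, ∀ a ∈ (P s).1, ∀ b ∈ (P s).2, e (t0 + s) ≤ dist a b := by
    intro s
    induction s with
    | zero =>
      intro a ha b hb
      obtain ⟨a', ha', haa⟩ := Metric.mem_thickening_iff.1 ha
      obtain ⟨b', hb', hbb⟩ := Metric.mem_thickening_iff.1 hb
      have h1 : δ ≤ dist a' b' := by
        by_contra hcon
        push Not at hcon
        refine disjoint_left.1 hd (Metric.mem_thickening_iff.2 ⟨a', ha', ?_⟩)
          (Metric.self_subset_thickening hδ _ hb')
        rwa [dist_comm]
      have h2 := dist_triangle4 a' a b b'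
      rw [dist_comm a' a] at h2
      simp only [add_zero]
      linarith
    | succ s ih =>
      rw [hPs]
      have h1 := he' (t0 + s)
      have h2 := he (t0 + s)
      rw [← add_assoc]
      rintro a (ha | ⟨v, ⟨hv, x, hx, a', ha', hxa⟩, hav⟩) b (hb | ⟨w, ⟨hw, hw'⟩, hbw⟩)
      · have := ih a ha b hb
        linarith
      · push Not at hw'
        have := hw' b hbw a ha
        rw [dist_comm]; linarith
      · have h3 := ih a' ha' b hb
        have h4 := (hV _ v hv).2 a hav x hx
        have h5 := dist_triangle4 a' x a b
        rw [dist_comm a' x, dist_comm x a] at h5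
        linarith
      · refine hV' _ v hv w hw ?_ a hav b hbw
        rintro rfl
        exact hw' ⟨x, hx, a', ha', hxa⟩
  have hopen : ∀ s, IsOpen (P s).1 ∧ IsOpen (P s).2 := by
    intro s
    induction s with
    | zero => exact ⟨Metric.isOpen_thickening, Metric.isOpen_thickening⟩
    | succ s ih =>
      rw [hPs]
      exact ⟨ih.1.union (isOpen_sUnion fun v hv => (hV _ v hv.1).1),
        ih.2.union (isOpen_sUnion fun v hv => (hV _ v hv.1).1)⟩
  have hm1 : Monotone fun s => (P s).1 := monotone_nat_of_le_succ fun s => by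
    change (P s).1 ⊆ (P (s + 1)).1
    rw [hPs]; exact subset_union_left
  have hm2 : Monotone fun s => (P s).2 := monotone_nat_of_le_succ fun s => by
    change (P s).2 ⊆ (P (s + 1)).2
    rw [hPs]; exact subset_union_left
  obtain ⟨u, hu0, hu⟩ := exists_cozero (isOpen_iUnion fun s => (hopen s).1)
  obtain ⟨w, hw0, hw⟩ := exists_cozero (isOpen_iUnion fun s => (hopen s).2)
  have hdis : ∀ x, x ∈ (⋃ s, (P s).1) → x ∉ ⋃ s, (P s).2 := by
    intro x hx hx'
    obtain ⟨s, hs⟩ := mem_iUnion.1 hx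
    obtain ⟨s', hs'⟩ := mem_iUnion.1 hx'
    have := hinv (max s s') x (hm1 (le_max_left _ _) hs) x (hm2 (le_max_right _ _) hs')
    rw [dist_self] at this
    exact (he _).not_ge this
  have hneg : ∀ x, x ∈ (⋃ s, (P s).1) → w x - u x < 0 := by
    intro x hx
    have h1 := (hu x).2 hx
    have h2 := not_lt.1 fun hh => hdis x hx ((hw x).1 hh)
    linarith
  have hpos : ∀ x, x ∈ (⋃ s, (P s).2) → 0 < w x - u x := by
    intro x hx
    have h1 := (hw x).2 hx
    have h2 := not_lt.1 fun hh => hdis x ((hu x).1 hh) hx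
    linarith
  refine ⟨w - u, fun x hx => hneg x (mem_iUnion.2 ⟨0, ?_⟩),
    fun x hx => hpos x (mem_iUnion.2 ⟨0, ?_⟩), ?_⟩
  · exact Metric.self_subset_thickening (by linarith) _ hx
  · exact Metric.self_subset_thickening (by linarith) _ hx
  · intro x hx
    obtain ⟨t, ht, v, hv, hxv⟩ := Filter.frequently_atTop.1 hx t0
    obtain ⟨s, rfl⟩ := Nat.exists_eq_add_of_le ht
    by_cases hc : ∃ x ∈ v, ∃ a ∈ (P s).1, dist x a < e (t0 + s) / 3
    · refine (hneg x (mem_iUnion.2 ⟨s + 1, ?_⟩)).ne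
      rw [hPs]
      exact Or.inr ⟨v, ⟨hv, hc⟩, hxv⟩
    · refine (hpos x (mem_iUnion.2 ⟨s + 1, ?_⟩)).ne'
      rw [hPs]
      exact Or.inr ⟨v, ⟨hv, hc⟩, hxv⟩

lemma CovDimLE.QD {C : Type} [MetricSpace C] [CompactSpace C] {m : ℕ} (h : CovDimLE C m) :
    QD C (m + 1) := by
  have key : ∀ ε : {ε : ℝ // 0 < ε}, ∃ δ > 0, ∃ V : Fin (m + 1) → Set (Set C),
      (∀ c, ∀ v ∈ V c, IsOpen v ∧ ∀ x ∈ v, ∀ y ∈ v, dist x y ≤ ε.1 / 3) ∧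
      (∀ c, ∀ v ∈ V c, ∀ w ∈ V c, v ≠ w → ∀ x ∈ v, ∀ y ∈ w, δ ≤ dist x y) ∧
      ∀ x, ∃ c, ∃ v ∈ V c, x ∈ v := fun ε =>
    colour_families h (show 0 < ε.1 / 3 by have := ε.2; linarith)
  choose δ hδ V hV1 hV2 hV3 using key
  let e : ℕ → {ε : ℝ // 0 < ε} := fun t => Nat.rec ⟨1, one_pos⟩
    (fun _ p => ⟨min (p.1 / 3) (δ p), lt_min (by have := p.2; linarith) (hδ p)⟩) t
  have hes : ∀ t, (e (t + 1)).1 = min ((e t).1 / 3) (δ (e t)) := fun t => rfl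
  refine ⟨fun c => {x | ∃ᶠ t in Filter.atTop, ∃ v ∈ V (e t) c, x ∈ v}, fun c => ?_, fun x => ?_⟩
  · refine sepSet_of_seq (fun t => (e t).1) (fun t => (e t).2) (fun t => ?_)
      (fun t => V (e t) c) (fun t => hV1 (e t) c) ?_
    · simp only [hes]; exact min_le_left _ _
    · intro t v hv w hw hne x hx y hy
      refine le_trans ?_ (hV2 (e t) c v hv w hw hne x hx y hy)
      simp only [hes]; exact min_le_right _ _
  · by_contra hcon
    simp only [mem_ofPred_eq, not_exists, Filter.not_frequently] at hcon
    have := Filter.eventually_all.2 hcon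
    obtain ⟨t, ht⟩ := this.exists
    obtain ⟨c, v, hv, hxv⟩ := hV3 (e t) x
    exact ht c v ⟨hv, hxv⟩

lemma SepSet.comap {X Y : Type} [TopologicalSpace X] [TopologicalSpace Y] {N : Set X}
    (hN : SepSet N) {e : Y → X} (he : IsClosedEmbedding e) : SepSet (e ⁻¹' N) := by
  intro A B hA hB hAB
  obtain ⟨h, h1, h2, h3⟩ := hN (e '' A) (e '' B) (he.isClosedMap _ hA) (he.isClosedMap _ hB)
    ((disjoint_image_iff he.injective).2 hAB)
  exact ⟨h.comp ⟨e, he.continuous⟩, fun x hx => h1 _ ⟨x, hx, rfl⟩, fun x hx => h2 _ ⟨x, hx, rfl⟩,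
    fun x hx => h3 _ hx⟩

lemma SepSet.mono {X : Type} [TopologicalSpace X] {N N' : Set X}
    (hN : SepSet N) (h : N' ⊆ N) : SepSet N' := by
  intro A B hA hB hAB
  obtain ⟨f, h1, h2, h3⟩ := hN A B hA hB hAB
  exact ⟨f, h1, h2, fun x hx => h3 x (h hx)⟩

lemma SepSet.empty {X : Type} [TopologicalSpace X] [NormalSpace X] : SepSet (∅ : Set X) := by
  intro A B hA hB hAB
  obtain ⟨f, h1, h2, -⟩ := exists_continuous_zero_one_of_isClosed hA hB hAB
  refine ⟨⟨fun x => f x - 1 / 2, by fun_prop⟩, fun x hx => ?_, fun x hx => ?_, by simp⟩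
  · have := h1 hx
    simp at this ⊢; rw [this]; norm_num
  · have := h2 hx
    simp at this ⊢; rw [this]; norm_num

lemma QD.pad {X : Type} [TopologicalSpace X] [NormalSpace X] {q q' : ℕ} (h : QD X q)
    (hq : q ≤ q') : QD X q' := by
  obtain ⟨N, hN, hc⟩ := h
  refine ⟨fun c => if hc : c.1 < q then N ⟨c.1, hc⟩ else ∅, fun c => ?_, fun x => ?_⟩
  · dsimp only
    split_ifs with hc
    · exact hN _
    · exact SepSet.empty
  · obtain ⟨c, hx⟩ := hc x
    exact ⟨⟨c.1, c.2.trans_le hq⟩, by simpa using hx⟩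

lemma QD.drop {X : Type} [TopologicalSpace X] {a b : ℕ} {N : Fin (a + b) → Set X}
    (hN : ∀ c, SepSet (N c)) (hc : ∀ x, ∃ c, x ∈ N c) {P : Set X} (hP : IsClosed P)
    (hPN : ∀ x ∈ P, ∀ c : Fin a, x ∉ N (Fin.castAdd b c)) : QD P b := by
  refine ⟨fun c => Subtype.val ⁻¹' N (Fin.natAdd a c),
    fun c => (hN _).comap hP.isClosedEmbedding_subtypeVal, fun x => ?_⟩
  obtain ⟨c, hx⟩ := hc x.1
  induction c using Fin.addCases with
  | left c => exact absurd hx (hPN x.1 x.2 c)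
  | right c => exact ⟨c, hx⟩

/-- radial projection on a subset where a map does not vanish -/
def nrm {X : Type} [TopologicalSpace X] {k : ℕ} (g : C(X, Esp k)) (U : Set X)
    (hU : ∀ x ∈ U, g x ≠ 0) : C(U, Sph k) where
  toFun x := ⟨‖g x.1‖⁻¹ • g x.1, by
    have := norm_ne_zero_iff.2 (hU x.1 x.2)
    simp [norm_smul, this]⟩
  continuous_toFun := by
    refine Continuous.subtype_mk ?_ _
    have hc : Continuous fun x : U => g x.1 := g.continuous.comp continuous_subtype_val
    exact (hc.norm.inv₀ fun x => norm_ne_zero_iff.2 (hU x.1 x.2)).smul hc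

lemma nrm_eq {X : Type} [TopologicalSpace X] {k : ℕ} (g : C(X, Esp k)) (U : Set X)
    (hU : ∀ x ∈ U, g x ≠ 0) (x : U) (hx : ‖g x.1‖ = 1) : (nrm g U hU x).1 = g x.1 := by
  simp [nrm, hx]

lemma LInd_crit {X : Type} [TopologicalSpace X] [NormalSpace X] {k : ℕ} {α : Ordinal.{0}}
    (h : ∀ F : Set X, IsClosed F → ∀ g0 : C(X, Esp k), (∀ x ∈ F, ‖g0 x‖ = 1) →
      ∃ U : Set X, IsOpen U ∧ ∃ hFU : F ⊆ U, (∃ g : C(U, Sph k), ∀ (x : X) (hx : x ∈ F),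
        (g ⟨x, hFU hx⟩).1 = g0 x) ∧
        (Uᶜ = (∅ : Set X) ∨ ∃ β < α, LIndLE (Sph k) (↥(Uᶜ)) β)) : LIndLE (Sph k) X α := by
  rw [LIndLE_iff]
  intro F hF f
  let f' : C(F, Esp k) := ⟨fun x => (f x).1, by fun_prop⟩
  obtain ⟨g0, hg0⟩ := ContinuousMap.exists_restrict_eq hF f'
  have hg1 : ∀ x (hx : x ∈ F), g0 x = (f ⟨x, hx⟩).1 := fun x hx => by
    exact DFunLike.congr_fun hg0 ⟨x, hx⟩
  obtain ⟨U, hU, hFU, ⟨g, hg⟩, h4⟩ := h F hF g0 fun x hx => by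
    rw [hg1 x hx]; exact mem_sphere_zero_iff_norm.1 (f ⟨x, hx⟩).2
  refine ⟨U, hU, hFU, ⟨g, fun x hx => Subtype.ext ?_⟩, h4⟩
  rw [hg x hx, hg1 x hx]

lemma sph_big {k : ℕ} (v : Esp k) (hv : ‖v‖ = 1) : ∃ i, 1 / ((k : ℝ) + 1) ≤ |v i| := by
  by_contra! hcon
  have h1 : ‖v‖ ^ 2 = ∑ i, ‖v i‖ ^ 2 := EuclideanSpace.norm_sq_eq v
  have h2 : ∑ i, ‖v i‖ ^ 2 ≤ ∑ i : Fin k, (1 / ((k : ℝ) + 1)) ^ 2 := by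
    refine Finset.sum_le_sum fun i _ => ?_
    have := hcon i
    rw [Real.norm_eq_abs]
    gcongr
  rw [← h1, hv] at h2
  simp only [one_pow, Finset.sum_const, Finset.card_univ, Fintype.card_fin, nsmul_eq_mul] at h2
  have h3 : (0 : ℝ) ≤ k := Nat.cast_nonneg k
  rw [div_pow, one_pow, mul_one_div, le_div_iff₀ (by positivity)] at h2
  nlinarith

lemma avoid {X : Type} [TopologicalSpace X] [NormalSpace X] {k : ℕ} (N : Fin k → Set X)
    (hN : ∀ i, SepSet (N i)) {F : Set X} (hF : IsClosed F) (g0 : C(X, Esp k))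
    (hg0 : ∀ x ∈ F, ‖g0 x‖ = 1) :
    ∃ g : C(X, Esp k), (∀ x ∈ F, g x = g0 x) ∧ ∀ x, g x = 0 → ∀ i, x ∉ N i := by
  set δ : ℝ := 1 / ((k : ℝ) + 1) with hδ
  have hδ0 : 0 < δ := by positivity
  have key : ∀ i, ∃ h : C(X, ℝ), (∀ x ∈ F ∩ {x | g0 x i ≤ -δ}, h x < 0) ∧
      (∀ x ∈ F ∩ {x | δ ≤ g0 x i}, 0 < h x) ∧ ∀ x ∈ N i, h x ≠ 0 := by
    intro i
    have hci : Continuous fun x => g0 x i := by fun_prop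
    refine hN i _ _ (hF.inter (isClosed_le hci continuous_const))
      (hF.inter (isClosed_le continuous_const hci)) ?_
    rw [disjoint_left]
    rintro x ⟨-, h1⟩ ⟨-, h2⟩
    simp only [mem_ofPred_eq] at h1 h2
    linarith
  choose h h1 h2 h3 using key
  let O : Set X := ⋃ i, {x | 0 < g0 x i * h i x}
  have hO : IsOpen O := isOpen_iUnion fun i => isOpen_lt continuous_const (by fun_prop)
  have hFO : ∀ x ∈ F, x ∈ O := by
    intro x hx
    obtain ⟨i, hi⟩ := sph_big (g0 x) (hg0 x hx)
    refine mem_iUnion.2 ⟨i, ?_⟩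
    simp only [mem_ofPred_eq]
    rcases le_abs.1 hi with hi | hi
    · exact mul_pos (hδ0.trans_le hi) (h2 i x ⟨hx, hi⟩)
    · have : g0 x i ≤ -δ := by linarith
      exact mul_pos_of_neg_of_neg (by linarith) (h1 i x ⟨hx, this⟩)
  obtain ⟨u, hu0, hu1, hu⟩ := exists_continuous_zero_one_of_isClosed hF hO.isClosed_compl
    (disjoint_left.2 fun x hx hx' => hx' (hFO x hx))
  let hh : C(X, Esp k) := ⟨fun x => WithLp.toLp 2 fun i => h i x, by
    exact (PiLp.continuous_toLp 2 _).comp (continuous_pi fun i => (h i).continuous)⟩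
  have hhi : ∀ x i, hh x i = h i x := fun x i => rfl
  refine ⟨⟨fun x => (1 - u x) • g0 x + u x • hh x, by fun_prop⟩, fun x hx => ?_, ?_⟩
  · have := hu0 hx
    simp only [Pi.zero_apply] at this
    simp [this]
  · intro x hx i hi
    have hxi : ∀ i, (1 - u x) * g0 x i + u x * h i x = 0 := by
      intro i
      have := congrArg (fun v : Esp k => v i) hx
      simpa [hhi] using this
    by_cases hxO : x ∈ O
    · obtain ⟨j, hj⟩ := mem_iUnion.1 hxO
      simp only [mem_ofPred_eq] at hj
      have h4 := hxi j
      have h5 : (1 - u x) * (g0 x j * h j x) + u x * (h j x) ^ 2 = 0 := by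
        linear_combination h j x * h4
      have h6 := (hu x).1
      have h7 := (hu x).2
      have h8 : h j x ≠ 0 := fun h0 => by simp [h0] at hj
      have h9 : 0 < h j x ^ 2 := by positivity
      rcases h7.lt_or_eq with h7 | h7
      · have := mul_pos (sub_pos.2 h7) hj
        have := mul_nonneg h6 h9.le
        linarith
      · rw [h7] at h5; linarith
    · have h4 := hu1 hxO
      simp only [Pi.one_apply] at h4
      have := hxi i
      rw [h4] at this
      exact h3 i x hi (by linarith)

lemma QD.LInd {k : ℕ} (n : ℕ) : ∀ {X : Type} [TopologicalSpace X] [CompactSpace X] [T2Space X],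
    QD X (k * (n + 1)) → LIndLE (Sph k) X (n : Ordinal.{0}) := by
  induction n with
  | zero =>
    intro X _ _ _ h
    obtain ⟨N, hN, hc⟩ := h
    refine LInd_crit fun F hF g0 hg0 => ?_
    obtain ⟨g, hg, hg'⟩ := avoid (fun i => N (Fin.cast (by simp) i)) (fun i => hN _) hF g0 hg0
    have hne : ∀ x, g x ≠ 0 := fun x hx => by
      obtain ⟨c, hxc⟩ := hc x
      exact hg' x hx (Fin.cast (by simp) c) hxc
    refine ⟨univ, isOpen_univ, subset_univ _, ⟨nrm g univ fun x _ => hne x, fun x hx => ?_⟩,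
      Or.inl compl_univ⟩
    rw [nrm_eq _ _ _ _ (by simp only [hg x hx, hg0 x hx])]
    exact hg x hx
  | succ n ih =>
    intro X _ _ _ h
    rw [show k * (n + 1 + 1) = k + k * (n + 1) by ring] at h
    obtain ⟨N, hN, hc⟩ := h
    refine LInd_crit fun F hF g0 hg0 => ?_
    obtain ⟨g, hg, hg'⟩ := avoid (fun i => N (Fin.castAdd _ i)) (fun i => hN _) hF g0 hg0
    have hcl : IsClosed {x | g x ≠ 0}ᶜ :=
      (isOpen_ne_fun g.continuous continuous_const).isClosed_compl
    refine ⟨{x | g x ≠ 0}, isOpen_ne_fun g.continuous continuous_const, fun x hx => ?_,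
      ⟨nrm g _ fun x hx => hx, fun x hx => ?_⟩, Or.inr ⟨n, ?_, ?_⟩⟩
    · have := hg0 x hx
      simp only [mem_ofPred_eq, hg x hx]
      rintro h0
      simp [h0] at this
    · rw [nrm_eq _ _ _ _ (by simp only [hg x hx, hg0 x hx])]
      exact hg x hx
    · exact_mod_cast Nat.lt_succ_self n
    · have : CompactSpace (↥({x | g x ≠ 0}ᶜ)) := isCompact_iff_compactSpace.1 hcl.isCompact
      refine ih (QD.drop hN hc hcl fun x hx c => hg' x ?_ c)
      simpa using hx

set_option linter.unusedSectionVars false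
section ZZ
variable {ι C : Type} [TopologicalSpace ι] [DiscreteTopology ι] [MetricSpace C] [CompactSpace C]
  [Nonempty C]

/-- the space `Z(C,C)` -/
abbrev ZZ (φ : ι → Set C) : Type := ZSpace ι C C φ

lemma one_isOpen_coe (i : ι) : IsOpen ({(i : OnePoint ι)} : Set (OnePoint ι)) := by
  have := OnePoint.isOpenEmbedding_coe.isOpenMap _ (isOpen_discrete ({i} : Set ι))
  simpa using this

lemma one_isClosed_coe (i : ι) : IsClosed ({(i : OnePoint ι)} : Set (OnePoint ι)) :=
  isClosed_singleton

lemma one_isClopen_coe (i : ι) : IsClopen ({(i : OnePoint ι)} : Set (OnePoint ι)) :=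
  ⟨one_isClosed_coe i, one_isOpen_coe i⟩

lemma one_isOpen_inf {U : Set (OnePoint ι)} (hU : IsOpen U) (h : OnePoint.infty ∈ U) :
    {i : ι | (i : OnePoint ι) ∉ U}.Finite := by
  have h1 := ((OnePoint.isOpen_iff_of_mem h).1 hU).2
  exact h1.finite_of_discrete

lemma one_nhds_inf {U : Set (OnePoint ι)} (hU : U ∈ 𝓝 (OnePoint.infty : OnePoint ι)) :
    {i : ι | (i : OnePoint ι) ∉ U}.Finite := by
  obtain ⟨V, hVU, hV, h⟩ := mem_nhds_iff.1 hU
  exact (one_isOpen_inf hV h).subset fun i hi h' => hi (hVU h')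

lemma one_nhds_of_finite {J : Set ι} (hJ : J.Finite) :
    {a : OnePoint ι | ∀ i ∈ J, a ≠ i} ∈ 𝓝 (OnePoint.infty : OnePoint ι) := by
  have : {a : OnePoint ι | ∀ i ∈ J, a ≠ i} = ⋂ i ∈ J, {(i : OnePoint ι)}ᶜ := by
    ext a; simp
  rw [this]
  refine (hJ.isOpen_biInter fun i _ => (one_isClosed_coe i).isOpen_compl).mem_nhds ?_
  simp

/-- level -/
def lev {φ : ι → Set C} (z : ZZ φ) : OnePoint ι :=
  Quot.lift (fun p : OnePoint ι × C × C => p.1) (fun _ _ h => h.1.trans h.2.1.symm) z.1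

/-- first coordinate -/
def pr {φ : ι → Set C} (z : ZZ φ) : C :=
  Quot.lift (fun p : OnePoint ι × C × C => p.2.1) (fun _ _ h => h.2.2) z.1

/-- second coordinate on the level `i` -/
def yy {φ : ι → Set C} (i : ι) (z : ZZ φ) : C :=
  Quot.lift (fun p : OnePoint ι × C × C => if p.1 = i then p.2.2 else Classical.arbitrary C)
    (fun p q h => by simp [h.1, h.2.1]) z.1

variable {φ : ι → Set C}

lemma lev_cont : Continuous (lev (φ := φ)) :=
  (continuous_quot_lift _ continuous_fst).comp continuous_subtype_val

lemma pr_cont : Continuous (pr (φ := φ)) :=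
  (continuous_quot_lift _ (continuous_fst.comp continuous_snd)).comp continuous_subtype_val

lemma yy_cont (i : ι) : Continuous (yy (φ := φ) i) := by
  refine (continuous_quot_lift _ ?_).comp continuous_subtype_val
  refine continuous_if ?_ (by fun_prop) (by fun_prop)
  intro p hp
  have : {p : OnePoint ι × C × C | p.1 = i} = Prod.fst ⁻¹' {(i : OnePoint ι)} := rfl
  rw [this, ((one_isClopen_coe i).preimage continuous_fst).frontier_eq] at hp
  exact absurd hp (notMem_empty p)

/-- points on the level at infinity -/
def mm (φ : ι → Set C) (x : C) : ZZ φ := ⟨Quot.mk _ (OnePoint.infty, x, x), _, rfl, Or.inl rfl⟩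

/-- points on finite levels -/
def pt (φ : ι → Set C) (i : ι) (s : φ i) (y : C) : ZZ φ :=
  ⟨Quot.mk _ ((i : OnePoint ι), s.1, y), _, rfl, Or.inr ⟨i, rfl, s.2⟩⟩

@[simp] lemma lev_mm (x : C) : lev (mm φ x) = OnePoint.infty := rfl
@[simp] lemma pr_mm (x : C) : pr (mm φ x) = x := rfl
@[simp] lemma lev_pt (i : ι) (s : φ i) (y : C) : lev (pt φ i s y) = i := rfl
@[simp] lemma pr_pt (i : ι) (s : φ i) (y : C) : pr (pt φ i s y) = s := rfl
@[simp] lemma yy_pt (i : ι) (s : φ i) (y : C) : yy i (pt φ i s y) = y := by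
  simp [yy, pt]

lemma zcases (z : ZZ φ) : (∃ x, z = mm φ x) ∨ ∃ i s y, z = pt φ i s y := by
  obtain ⟨z, ⟨a, x, y⟩, rfl, h⟩ := z
  rcases h with h | ⟨i, h, hx⟩
  · left
    refine ⟨x, Subtype.ext (Quot.sound ⟨h, rfl, rfl⟩)⟩
  · right
    obtain rfl : a = i := h
    exact ⟨i, ⟨x, hx⟩, y, rfl⟩

lemma eq_mm {z : ZZ φ} (h : lev z = OnePoint.infty) : z = mm φ (pr z) := by
  rcases zcases z with ⟨x, rfl⟩ | ⟨i, s, y, rfl⟩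
  · rfl
  · simp at h

lemma pr_mem {z : ZZ φ} {i : ι} (h : lev z = i) : pr z ∈ φ i := by
  rcases zcases z with ⟨x, rfl⟩ | ⟨j, s, y, rfl⟩
  · simp at h
  · simp only [lev_pt, OnePoint.coe_eq_coe] at h
    subst h
    exact s.2

lemma eq_pt {z : ZZ φ} {i : ι} (h : lev z = i) : z = pt φ i ⟨pr z, pr_mem h⟩ (yy i z) := by
  rcases zcases z with ⟨x, rfl⟩ | ⟨j, s, y, rfl⟩
  · simp at h
  · simp only [lev_pt, OnePoint.coe_eq_coe] at h
    subst h
    simp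

lemma lev_cases (z : ZZ φ) : lev z = OnePoint.infty ∨ ∃ i : ι, lev z = i := by
  rcases zcases z with ⟨x, rfl⟩ | ⟨j, s, y, rfl⟩
  · exact Or.inl rfl
  · exact Or.inr ⟨j, rfl⟩

lemma sfam_closed {S : Set C} (h : S ∈ SFam C) : IsClosed S := by
  rcases h with h | ⟨⟨e⟩⟩
  · exact h.isClosed
  · have : CompactSpace S := e.symm.compactSpace
    exact (isCompact_iff_compactSpace.2 this).isClosed

lemma sfam_lim {S : Set C} (h : S ∈ SFam C) :
    ∃ x0 : C, ∀ x ∈ S, x ≠ x0 → ∃ O : Set C, IsOpen O ∧ O ∩ S = {x} := by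
  rcases h with h | ⟨⟨e⟩⟩
  · refine ⟨Classical.arbitrary C, fun x hx _ => ⟨(S \ {x})ᶜ,
      (h.subset sdiff_subset).isClosed.isOpen_compl, ?_⟩⟩
    ext y
    simp only [mem_inter_iff, mem_compl_iff, mem_sdiff, mem_singleton_iff, not_and, not_not]
    exact ⟨fun h => h.1 h.2, fun h => by simp [h, hx]⟩
  · refine ⟨(e.symm OnePoint.infty).1, fun x hx hne => ?_⟩
    have h1 : e ⟨x, hx⟩ ≠ OnePoint.infty := fun h => hne (by rw [← h]; simp)
    obtain ⟨n, hn⟩ := OnePoint.ne_infty_iff_exists.1 h1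
    have h2 : IsOpen (e ⁻¹' {(n : OnePoint ℕ)}) := (one_isOpen_coe n).preimage e.continuous
    obtain ⟨O, hO, hO'⟩ := isOpen_induced_iff.1 h2
    refine ⟨O, hO, ?_⟩
    ext y
    constructor
    · rintro ⟨hy, hyS⟩
      have : (⟨y, hyS⟩ : S) ∈ e ⁻¹' {(n : OnePoint ℕ)} := by rw [← hO']; exact hy
      have h3 : e ⟨y, hyS⟩ = e ⟨x, hx⟩ := by rw [← hn]; exact this
      simpa using e.injective h3
    · rintro rfl
      refine ⟨?_, hx⟩
      have : (⟨y, hx⟩ : S) ∈ Subtype.val ⁻¹' O := by rw [hO']; exact hn.symm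
      exact this

/-- the set of representatives -/
def Dst (φ : ι → Set C) : Set (OnePoint ι × C × C) :=
  {p | p.1 = OnePoint.infty ∨ ∃ i : ι, p.1 = (i : OnePoint ι) ∧ p.2.1 ∈ φ i}

lemma Dst_closed (hφ : ∀ i, φ i ∈ SFam C) : IsClosed (Dst φ) := by
  have : (Dst φ)ᶜ = ⋃ i : ι, ({(i : OnePoint ι)} ×ˢ ((φ i)ᶜ ×ˢ (univ : Set C))) := by
    ext ⟨a, x, y⟩
    induction a using OnePoint.rec with
    | infty => simp [Dst]
    | coe i => simp [Dst]
  rw [← isOpen_compl_iff, this]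
  exact isOpen_iUnion fun i => (one_isOpen_coe i).prod
    ((sfam_closed (hφ i)).isOpen_compl.prod isOpen_univ)

/-- the canonical map onto `Z` -/
def qD (p : Dst φ) : ZZ φ := ⟨Quot.mk _ p.1, p.1, rfl, p.2⟩

lemma qD_cont : Continuous (qD (φ := φ)) :=
  Continuous.subtype_mk (continuous_quot_mk.comp continuous_subtype_val) _

lemma qD_surj : Function.Surjective (qD (φ := φ)) := by
  rintro ⟨z, p, rfl, h⟩
  exact ⟨⟨p, h⟩, rfl⟩

lemma zz_compact (hφ : ∀ i, φ i ∈ SFam C) : CompactSpace (ZZ φ) := by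
  have : CompactSpace (Dst φ) := isCompact_iff_compactSpace.1 (Dst_closed hφ).isCompact
  exact qD_surj.compactSpace qD_cont

/-- an embedding of `Z` in a product -/
def emb (z : ZZ φ) : OnePoint ι × C × (ι → C) := (lev z, pr z, fun i => yy i z)

lemma emb_cont : Continuous (emb (φ := φ)) :=
  lev_cont.prodMk (pr_cont.prodMk (continuous_pi yy_cont))

lemma emb_inj : Function.Injective (emb (φ := φ)) := by
  intro z w h
  simp only [emb, Prod.mk.injEq] at h
  obtain ⟨h1, h2, h3⟩ := h
  rcases lev_cases z with hz | ⟨i, hz⟩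
  · have hw : lev w = OnePoint.infty := h1 ▸ hz
    rw [eq_mm hz, eq_mm hw, h2]
  · have h4 := congrFun h3 i
    have hw : lev w = i := h1 ▸ hz
    rw [eq_pt hz, eq_pt hw, h4]
    congr 1
    exact Subtype.ext h2

instance zz_t2 : T2Space (ZZ φ) := T2Space.of_injective_continuous emb_inj emb_cont

lemma emb_closed (hφ : ∀ i, φ i ∈ SFam C) : IsClosedEmbedding (emb (φ := φ)) :=
  have := zz_compact hφ
  emb_cont.isClosedEmbedding emb_inj

lemma yy_ne {z : ZZ φ} {i : ι} (h : lev z ≠ i) : yy i z = Classical.arbitrary C := by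
  obtain ⟨z, p, rfl, hp⟩ := z
  have h' : p.1 ≠ i := h
  simp [yy, h']

lemma zz_nhds_inf (hφ : ∀ i, φ i ∈ SFam C) {z : ZZ φ} (hz : lev z = OnePoint.infty) :
    𝓝 z = Filter.comap lev (𝓝 OnePoint.infty) ⊓ Filter.comap pr (𝓝 (pr z)) := by
  apply le_antisymm
  · exact le_inf (Filter.map_le_iff_le_comap.1 (hz ▸ lev_cont.tendsto z))
      (Filter.map_le_iff_le_comap.1 (pr_cont.tendsto z))
  · rw [(emb_closed hφ).isInducing.nhds_eq_comap, ← Filter.map_le_iff_le_comap]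
    change Filter.Tendsto emb _ _
    have h1 : Filter.Tendsto (lev (φ := φ)) (Filter.comap lev (𝓝 OnePoint.infty) ⊓
        Filter.comap pr (𝓝 (pr z))) (𝓝 (lev z)) := by
      rw [hz]; exact Filter.tendsto_comap.mono_left inf_le_left
    refine h1.prodMk_nhds ((Filter.tendsto_comap.mono_left inf_le_right).prodMk_nhds ?_)
    rw [tendsto_pi_nhds]
    intro i
    refine tendsto_nhds_of_eventually_eq ?_
    rw [hz] at h1
    have h2 := h1 (one_nhds_of_finite (finite_singleton i))
    filter_upwards [h2] with w hw
    rw [yy_ne (hw i rfl), yy_ne (show lev z ≠ i by rw [hz]; simp)]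

lemma level_clopen (i : ι) : IsClopen {z : ZZ φ | lev z = i} :=
  (one_isClopen_coe i).preimage lev_cont

lemma zz_nhds_fin (hφ : ∀ i, φ i ∈ SFam C) {z : ZZ φ} {i : ι} (hz : lev z = i) :
    𝓝 z = Filter.principal {z : ZZ φ | lev z = i} ⊓ Filter.comap pr (𝓝 (pr z)) ⊓
      Filter.comap (yy i) (𝓝 (yy i z)) := by
  apply le_antisymm
  · exact le_inf (le_inf (Filter.le_principal_iff.2 ((level_clopen i).isOpen.mem_nhds hz))
      (Filter.map_le_iff_le_comap.1 (pr_cont.tendsto z)))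
      (Filter.map_le_iff_le_comap.1 ((yy_cont i).tendsto z))
  · rw [(emb_closed hφ).isInducing.nhds_eq_comap, ← Filter.map_le_iff_le_comap]
    change Filter.Tendsto emb _ _
    have h0 : {z : ZZ φ | lev z = i} ∈ Filter.principal {z : ZZ φ | lev z = i} ⊓
        Filter.comap pr (𝓝 (pr z)) ⊓ Filter.comap (yy i) (𝓝 (yy i z)) :=
      Filter.mem_inf_of_left (Filter.mem_inf_of_left (Filter.mem_principal_self _))
    refine Filter.Tendsto.prodMk_nhds ?_
      ((Filter.tendsto_comap.mono_left (inf_le_left.trans inf_le_right)).prodMk_nhds ?_)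
    · refine tendsto_nhds_of_eventually_eq ?_
      filter_upwards [h0] with w hw
      rw [hz]; exact hw
    · rw [tendsto_pi_nhds]
      intro j
      by_cases hj : j = i
      · subst hj
        exact Filter.tendsto_comap.mono_left inf_le_right
      · refine tendsto_nhds_of_eventually_eq ?_
        filter_upwards [h0] with w hw
        have hne : (i : OnePoint ι) ≠ j := by simpa using Ne.symm hj
        rw [yy_ne (show lev w ≠ j by rw [hw]; exact hne), yy_ne (show lev z ≠ j by rw [hz]; exact hne)]

end ZZ

set_option linter.unusedSectionVars false
section ZZ
variable {ι C : Type} [TopologicalSpace ι] [DiscreteTopology ι] [MetricSpace C] [CompactSpace C]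
  [Nonempty C] {φ : ι → Set C}

lemma mm_cont : Continuous (mm φ) := by
  refine Continuous.subtype_mk (continuous_quot_mk.comp ?_) _
  fun_prop

lemma mm_emb : IsClosedEmbedding (mm φ) :=
  mm_cont.isClosedEmbedding fun x y h => by simpa using congrArg pr h

lemma pt_cont (i : ι) : Continuous fun p : φ i × C => pt φ i p.1 p.2 := by
  refine Continuous.subtype_mk (continuous_quot_mk.comp ?_) _
  fun_prop

lemma pt_emb (hφ : ∀ i, φ i ∈ SFam C) (i : ι) :
    IsClosedEmbedding fun p : φ i × C => pt φ i p.1 p.2 := by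
  have : CompactSpace (φ i) := isCompact_iff_compactSpace.1 (sfam_closed (hφ i)).isCompact
  refine (pt_cont i).isClosedEmbedding fun p q h => ?_
  have h1 := congrArg pr h
  have h2 := congrArg (yy i) h
  simp only [pr_pt, yy_pt] at h1 h2
  exact Prod.ext (Subtype.ext h1) h2

lemma pt_emb_y (i : ι) (s : φ i) : IsClosedEmbedding (pt φ i s) := by
  refine ((pt_cont i).comp (continuous_const.prodMk continuous_id)).isClosedEmbedding
    fun p q h => ?_
  have h2 := congrArg (yy i) h
  simpa using h2

lemma comp_sub_level {z w : ZZ φ} (h : w ∈ connectedComponent z) {i : ι} (hz : lev z = i) :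
    lev w = i :=
  (level_clopen i).connectedComponent_subset hz h

lemma iso_clopen {i : ι} {x : C} (hx : ∃ O : Set C, IsOpen O ∧ O ∩ φ i = {x}) :
    IsClopen {z : ZZ φ | lev z = i ∧ pr z = x} := by
  obtain ⟨O, hO, hOx⟩ := hx
  have hmem : ∀ z : ZZ φ, lev z = i → (pr z ∈ O ↔ pr z = x) := by
    intro z hz
    constructor
    · intro h
      have : pr z ∈ O ∩ φ i := ⟨h, pr_mem hz⟩
      rw [hOx] at this
      exact this
    · rintro rfl
      have : pr z ∈ O ∩ φ i := by rw [hOx]; rfl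
      exact this.1
  constructor
  · exact (level_clopen i).isClosed.inter (isClosed_singleton.preimage pr_cont)
  · have : {z : ZZ φ | lev z = i ∧ pr z = x} = {z | lev z = i} ∩ pr ⁻¹' O := by
      ext z
      simp only [mem_ofPred_eq, mem_inter_iff, mem_preimage]
      exact and_congr_right fun hz => (hmem z hz).symm
    rw [this]
    exact (level_clopen i).isOpen.inter (hO.preimage pr_cont)

lemma zz_component [ConnectedSpace C] (hφ : ∀ i, φ i ∈ SFam C) (z : ZZ φ) :
    Nonempty (↥(connectedComponent z) ≃ₜ C) := by
  have main : ∀ f : C → ZZ φ, IsClosedEmbedding f → connectedComponent z = range f →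
      Nonempty (↥(connectedComponent z) ≃ₜ C) := by
    intro f hf h
    rw [h]
    exact ⟨hf.isEmbedding.toHomeomorph.symm⟩
  rcases lev_cases z with hz | ⟨i, hz⟩
  · refine main (mm φ) mm_emb (subset_antisymm (fun w hw => ?_) ?_)
    · refine ⟨pr w, (eq_mm ?_).symm⟩
      rcases lev_cases w with h | ⟨i, h⟩
      · exact h
      · have := comp_sub_level (connectedComponent_eq hw ▸ mem_connectedComponent) h (w := z)
        rw [hz] at this
        exact absurd this (OnePoint.infty_ne_coe i)
    · refine (isPreconnected_range mm_cont).subset_connectedComponent ?_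
      rw [eq_mm hz]; exact mem_range_self _
  · refine main (pt φ i ⟨pr z, pr_mem hz⟩) (pt_emb_y i _) (subset_antisymm (fun w hw => ?_) ?_)
    · have hw' := comp_sub_level hw hz
      have hpr : pr w = pr z := by
        by_contra hne
        obtain ⟨x0, hx0⟩ := sfam_lim (hφ i)
        by_cases h0 : pr z = x0
        · have h1 := iso_clopen (hx0 (pr w) (pr_mem hw') (h0 ▸ hne))
          have h2 := h1.connectedComponent_subset (x := w) ⟨hw', rfl⟩
            (connectedComponent_eq hw ▸ mem_connectedComponent : z ∈ connectedComponent w)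
          exact hne h2.2.symm
        · have h1 := iso_clopen (hx0 (pr z) (pr_mem hz) h0)
          exact hne (h1.connectedComponent_subset (x := z) ⟨hz, rfl⟩ hw).2
      refine ⟨yy i w, ?_⟩
      rw [eq_pt hw']
      simp [hpr]
    · refine (isPreconnected_range (pt_emb_y i _).continuous).subset_connectedComponent ?_
      exact ⟨yy i z, (eq_pt hz).symm⟩

lemma zz_frechet (hφ : ∀ i, φ i ∈ SFam C) : FrechetUrysohnSpace (ZZ φ) := by
  refine ⟨fun A z hz => ?_⟩
  have hz' := mem_closure_iff_frequently.1 hz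
  rcases lev_cases z with hl | ⟨i, hl⟩
  swap
  · rw [zz_nhds_fin hφ hl] at hz'
    obtain ⟨s, hs, hsA⟩ := Filter.exists_seq_forall_of_frequently hz'
    rw [← zz_nhds_fin hφ hl] at hs
    exact ⟨s, hsA, hs⟩
  by_cases hc : ∃ᶠ w in Filter.principal {w : ZZ φ | lev w = OnePoint.infty} ⊓
      Filter.comap pr (𝓝 (pr z)), w ∈ A
  · obtain ⟨s, hs, hsA⟩ := Filter.exists_seq_forall_of_frequently hc
    refine ⟨s, hsA, hs.mono_right ?_⟩
    rw [zz_nhds_inf hφ hl]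
    refine inf_le_inf_right _ ?_
    intro T hT
    obtain ⟨V, hV, hVT⟩ := Filter.mem_comap.1 hT
    refine Filter.mem_principal.2 fun w hw => hVT ?_
    have : lev w = OnePoint.infty := hw
    rw [mem_preimage, this]
    exact mem_of_mem_nhds hV
  · rw [Filter.not_frequently, inf_comm, Filter.eventually_inf_principal,
      Filter.eventually_comap] at hc
    obtain ⟨r0, hr0, hr⟩ := Metric.eventually_nhds_iff.1 hc
    obtain ⟨f, hf1, hf2⟩ := exists_seq_of_forall_finset_exists
      (fun p : ZZ φ × ℕ => p.1 ∈ A ∧ lev p.1 ≠ OnePoint.infty ∧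
        dist (pr p.1) (pr z) < 1 / ((p.2 : ℝ) + 1))
      (fun p q => p.2 < q.2 ∧ lev p.1 ≠ lev q.1) (by
        intro s hs
        set n : ℕ := s.sup (fun p => p.2) + 1 with hn
        have h1 : {w : ZZ φ | dist (pr w) (pr z) < min r0 (1 / ((n : ℝ) + 1))} ∈ 𝓝 z := by
          refine (isOpen_lt (pr_cont.dist continuous_const) continuous_const).mem_nhds ?_
          simp only [mem_ofPred_eq, dist_self]
          positivity
        have h2 : (⋂ p ∈ s, {w : ZZ φ | lev w = lev p.1}ᶜ) ∈ 𝓝 z := by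
          rw [Filter.biInter_finset_mem]
          intro p hp
          refine ((isClosed_singleton.preimage lev_cont).isOpen_compl.mem_nhds ?_ :
            (lev (φ := φ) ⁻¹' {lev p.1})ᶜ ∈ 𝓝 z)
          intro h
          exact (hs p hp).2.1 (by rw [← hl]; exact h.symm)
        obtain ⟨w, hwA, hw1, hw2⟩ := (hz'.and_eventually (Filter.inter_mem h1 h2)).exists
        have hw1' : _ ∧ _ := lt_min_iff.1 (show dist (pr w) (pr z) < min r0 (1 / ((n : ℝ) + 1)) from hw1)
        refine ⟨(w, n), ⟨hwA, fun h => ?_, hw1'.2⟩, fun p hp => ⟨?_, ?_⟩⟩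
        · exact hr hw1'.1 w rfl h hwA
        · exact Nat.lt_succ_of_le (Finset.le_sup (f := fun p => p.2) hp)
        · have := mem_iInter₂.1 hw2 p hp
          exact fun h => this h.symm)
    refine ⟨fun n => (f n).1, fun n => (hf1 n).1, ?_⟩
    rw [zz_nhds_inf hφ hl, Filter.tendsto_inf, Filter.tendsto_comap_iff, Filter.tendsto_comap_iff]
    have hmono : StrictMono fun n => (f n).2 := fun a b hab => (hf2 a b hab).1
    have hinj : Function.Injective fun n => lev (f n).1 := by
      intro a b hab
      by_contra hne
      rcases lt_or_gt_of_ne hne with h | h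
      · exact (hf2 a b h).2 hab
      · exact (hf2 b a h).2 hab.symm
    constructor
    · intro U hU
      have h1 := one_nhds_inf hU
      have h2 : ({n | lev (f n).1 ∉ U}).Finite := by
        refine Set.Finite.subset ((h1.image (fun i : ι => (i : OnePoint ι))).preimage
          (f := fun n => lev (f n).1) hinj.injOn) fun n hn => ?_
        rcases lev_cases (f n).1 with h | ⟨i, h⟩
        · exact absurd h (hf1 n).2.1
        · refine ⟨i, ?_, h.symm⟩
          rw [mem_ofPred_eq, ← h]; exact hn
      have h3 := h2.eventually_cofinite_notMem
      rw [Nat.cofinite_eq_atTop] at h3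
      refine Filter.mem_map.2 ?_
      filter_upwards [h3] with n hn
      simpa using hn
    · rw [tendsto_iff_dist_tendsto_zero]
      refine squeeze_zero (fun _ => dist_nonneg) (fun n => ?_)
        tendsto_one_div_add_atTop_nhds_zero_nat
      refine (hf1 n).2.2.le.trans (one_div_le_one_div_of_le (by positivity) ?_)
      have := hmono.id_le n
      simp only [id] at this
      have : (n : ℝ) ≤ (f n).2 := by exact_mod_cast this
      linarith

end ZZ

set_option linter.unusedSectionVars false
section ZZ
variable {ι C : Type} [TopologicalSpace ι] [DiscreteTopology ι] [MetricSpace C] [CompactSpace C]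
  [Nonempty C] {φ : ι → Set C}

lemma sfam_retr {S : Set C} (hS : S ∈ SFam C) (O : S → Set S) (hO : ∀ s, O s ∈ 𝓝 s) :
    ∃ r : S → S, (∀ s, s ∈ O (r s)) ∧ ∀ s, ∀ᶠ s' in 𝓝 s, r s' = r s := by
  obtain ⟨x0, hx0⟩ := sfam_lim hS
  have hiso : ∀ s : S, s.1 ≠ x0 → ({s} : Set S) ∈ 𝓝 s := by
    intro s hs
    obtain ⟨U, hU, hUs⟩ := hx0 s.1 s.2 hs
    have hsU : s.1 ∈ U := by
      have : s.1 ∈ U ∩ S := by rw [hUs]; rfl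
      exact this.1
    refine Filter.mem_of_superset ((hU.preimage continuous_subtype_val).mem_nhds hsU) ?_
    intro t ht
    have : t.1 ∈ U ∩ S := ⟨ht, t.2⟩
    rw [hUs] at this
    exact Subtype.ext this
  by_cases h0 : x0 ∈ S
  · obtain ⟨W, hW, hWo, hxW⟩ := mem_nhds_iff.1 (hO ⟨x0, h0⟩)
    refine ⟨fun s => if s ∈ W then ⟨x0, h0⟩ else s, fun s => ?_, fun s => ?_⟩
    · dsimp only
      split_ifs with h
      · exact hW h
      · exact mem_of_mem_nhds (hO s)
    · by_cases h : s ∈ W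
      · filter_upwards [hWo.mem_nhds h] with t ht
        simp [h, ht]
      · have hne : s.1 ≠ x0 := by
          intro heq
          apply h
          convert hxW
        filter_upwards [hiso s hne] with t ht
        rw [mem_singleton_iff.1 ht]
  · refine ⟨id, fun s => mem_of_mem_nhds (hO s), fun s => ?_⟩
    filter_upwards [hiso s fun h => h0 (h ▸ s.2)] with t ht
    exact ht

lemma SepSet.prodS {S : Set C} (hS : S ∈ SFam C) {N : Set C} (hN : SepSet N) :
    SepSet {p : S × C | p.2 ∈ N} := by
  intro A B hA hB hAB
  have key : ∀ s : S, ∃ h : C(C, ℝ), (∀ y, (s, y) ∈ A → h y < 0) ∧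
      (∀ y, (s, y) ∈ B → 0 < h y) ∧ ∀ y ∈ N, h y ≠ 0 := fun s =>
    hN {y | (s, y) ∈ A} {y | (s, y) ∈ B} (hA.preimage (by fun_prop)) (hB.preimage (by fun_prop))
      (disjoint_left.2 fun y h1 h2 => disjoint_left.1 hAB h1 h2)
  choose h h1 h2 h3 using key
  obtain ⟨r, hr, hr'⟩ := sfam_retr hS (fun s => {t | ∀ y, ((t, y) ∈ A → h s y < 0) ∧
      ((t, y) ∈ B → 0 < h s y)}) (fun s => by
    have hc : IsClosed (A ∩ {p : S × C | 0 ≤ h s p.2} ∪ B ∩ {p : S × C | h s p.2 ≤ 0}) :=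
      (hA.inter (isClosed_le continuous_const (by fun_prop))).union
        (hB.inter (isClosed_le (by fun_prop) continuous_const))
    have hc' := isClosedMap_fst_of_compactSpace (X := S) (Y := C) _ hc
    refine Filter.mem_of_superset (hc'.isOpen_compl.mem_nhds ?_) ?_
    · rintro ⟨⟨t, y⟩, h', rfl⟩
      rcases h' with ⟨h4, h5⟩ | ⟨h4, h5⟩
      · exact absurd (h1 t y h4) (not_lt.2 h5)
      · exact absurd (h2 t y h4) (not_lt.2 h5)
    · intro t ht y
      constructor
      · intro hA'
        by_contra hcon
        exact ht ⟨(t, y), Or.inl ⟨hA', not_lt.1 hcon⟩, rfl⟩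
      · intro hB'
        by_contra hcon
        exact ht ⟨(t, y), Or.inr ⟨hB', not_lt.1 hcon⟩, rfl⟩)
  refine ⟨⟨fun p => h (r p.1) p.2, ?_⟩, fun p hp => (hr p.1 p.2).1 hp,
    fun p hp => (hr p.1 p.2).2 hp, fun p hp => h3 _ _ hp⟩
  rw [continuous_iff_continuousAt]
  intro p
  have : ContinuousAt (fun q : S × C => h (r p.1) q.2) p := by fun_prop
  refine this.congr ?_
  filter_upwards [(continuous_fst.tendsto p).eventually (hr' p.1)] with q hq
  rw [hq]

/-- finitely many levels and the one at infinity -/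
def ZJ (φ : ι → Set C) (J : Set ι) : Set (ZZ φ) := {z | ∀ i : ι, lev z = i → i ∈ J}

lemma ZJ_closed (J : Set ι) : IsClosed (ZJ φ J) := by
  have : (ZJ φ J)ᶜ = ⋃ i ∈ Jᶜ, {z : ZZ φ | lev z = i} := by
    ext z; simp [ZJ, and_comm]
  rw [← isOpen_compl_iff, this]
  exact isOpen_biUnion fun i _ => (level_clopen i).isOpen

lemma lev_loc {J : Set ι} (hJ : J.Finite) (z : ZJ φ J) :
    ∀ᶠ w : ZJ φ J in 𝓝 z, lev w.1 = lev z.1 := by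
  rcases lev_cases z.1 with hz | ⟨i, hz⟩
  · have h1 := ((lev_cont (φ := φ)).comp continuous_subtype_val).tendsto z
      (hz ▸ one_nhds_of_finite hJ)
    filter_upwards [h1] with w hw
    rw [hz]
    rcases lev_cases w.1 with hw' | ⟨j, hw'⟩
    · exact hw'
    · exact absurd hw' (hw j (w.2 j hw'))
  · have := ((level_clopen (φ := φ) i).isOpen.preimage
      (continuous_subtype_val (p := (· ∈ ZJ φ J)))).mem_nhds (x := z) hz
    filter_upwards [this] with w hw
    rw [hz]; exact hw

lemma glueJ {E : Type} [TopologicalSpace E] {J : Set ι} (hJ : J.Finite)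
    (T : OnePoint ι → C(ZZ φ, E)) : Continuous fun z : ZJ φ J => T (lev z.1) z.1 := by
  rw [continuous_iff_continuousAt]
  intro z
  have : ContinuousAt (fun w : ZJ φ J => T (lev z.1) w.1) z := by fun_prop
  refine this.congr ?_
  filter_upwards [lev_loc hJ z] with w hw
  rw [hw]

/-- the subsets of `Z` corresponding to subsets of `C` -/
def NZ (φ : ι → Set C) (N : Set C) : Set (ZZ φ) :=
  {z | (lev z = OnePoint.infty → pr z ∈ N) ∧ ∀ i : ι, lev z = i → yy i z ∈ N}

lemma NZ_cover {q : ℕ} {N : Fin q → Set C} (h : ∀ x, ∃ c, x ∈ N c) (z : ZZ φ) :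
    ∃ c, z ∈ NZ φ (N c) := by
  rcases lev_cases z with hz | ⟨i, hz⟩
  · obtain ⟨c, hc⟩ := h (pr z)
    exact ⟨c, fun _ => hc, fun i hi => by rw [hz] at hi; exact absurd hi (OnePoint.infty_ne_coe i)⟩
  · obtain ⟨c, hc⟩ := h (yy i z)
    refine ⟨c, fun h => by rw [hz] at h; exact absurd h (OnePoint.coe_ne_infty i), fun j hj => ?_⟩
    rw [hz, OnePoint.coe_eq_coe] at hj
    exact hj ▸ hc

lemma NZ_sep (hφ : ∀ i, φ i ∈ SFam C) {N : Set C} (hN : SepSet N) {J : Set ι} (hJ : J.Finite) :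
    SepSet (Subtype.val ⁻¹' NZ φ N : Set (ZJ φ J)) := by
  have := zz_compact hφ
  intro A B hA hB hAB
  have hemb := (ZJ_closed (φ := φ) J).isClosedEmbedding_subtypeVal
  have hA' := hemb.isClosedMap _ hA
  have hB' := hemb.isClosedMap _ hB
  have hAB' : Disjoint (Subtype.val '' A) (Subtype.val '' B) :=
    (disjoint_image_iff Subtype.val_injective).2 hAB
  set A' := Subtype.val '' A
  set B' := Subtype.val '' B
  have key : ∀ a : OnePoint ι, ∃ h : C(ZZ φ, ℝ), ∀ z, lev z = a →
      (z ∈ A' → h z < 0) ∧ (z ∈ B' → 0 < h z) ∧ (z ∈ NZ φ N → h z ≠ 0) := by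
    intro a
    induction a using OnePoint.rec with
    | infty =>
      obtain ⟨h, h1, h2, h3⟩ := hN (mm φ ⁻¹' A') (mm φ ⁻¹' B') (hA'.preimage mm_cont)
        (hB'.preimage mm_cont) (hAB'.preimage _)
      refine ⟨h.comp ⟨pr, pr_cont⟩, fun z hz => ⟨fun hzA => h1 _ ?_, fun hzA => h2 _ ?_,
        fun hzN => h3 _ (hzN.1 hz)⟩⟩
      · rw [mem_preimage, ContinuousMap.coe_mk, ← eq_mm hz]; exact hzA
      · rw [mem_preimage, ContinuousMap.coe_mk, ← eq_mm hz]; exact hzA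
    | coe i =>
      obtain ⟨h, h1, h2, h3⟩ := (hN.prodS (hφ i)) ((fun p : φ i × C => pt φ i p.1 p.2) ⁻¹' A')
        ((fun p : φ i × C => pt φ i p.1 p.2) ⁻¹' B') (hA'.preimage (pt_cont i))
        (hB'.preimage (pt_cont i)) (hAB'.preimage _)
      obtain ⟨g, hg⟩ := ContinuousMap.exists_extension (pt_emb hφ i) h
      have hg' : ∀ z : ZZ φ, ∀ hz : lev z = i, g z = h (⟨pr z, pr_mem hz⟩, yy i z) := by
        intro z hz
        have h4 := DFunLike.congr_fun hg (⟨pr z, pr_mem hz⟩, yy i z)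
        rw [← h4]
        exact congrArg g (eq_pt hz)
      refine ⟨g, fun z hz => ?_⟩
      rw [hg' z hz]
      refine ⟨fun hzA => h1 _ ?_, fun hzA => h2 _ ?_, fun hzN => h3 _ (hzN.2 i hz)⟩
      · rw [mem_preimage, ← eq_pt hz]; exact hzA
      · rw [mem_preimage, ← eq_pt hz]; exact hzA
  choose T hT using key
  exact ⟨⟨_, glueJ hJ T⟩, fun z hz => (hT _ z.1 rfl).1 ⟨z, hz, rfl⟩,
    fun z hz => (hT _ z.1 rfl).2.1 ⟨z, hz, rfl⟩, fun z hz => (hT _ z.1 rfl).2.2 hz⟩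

lemma levels_finite (hφ : ∀ i, φ i ∈ SFam C) {K : Set (ZZ φ)} (hK : IsClosed K)
    (h : ∀ z ∈ K, lev z ≠ OnePoint.infty) : {i : ι | ∃ z ∈ K, lev z = i}.Finite := by
  have := zz_compact hφ
  have h1 : IsOpen (lev '' K)ᶜ := (hK.isCompact.image lev_cont).isClosed.isOpen_compl
  refine (one_isOpen_inf h1 ?_).subset ?_
  · rintro ⟨z, hz, h'⟩
    exact h z hz h'
  · rintro i ⟨z, hz, h'⟩ hi
    exact hi ⟨z, hz, h'⟩

end ZZ

set_option linter.unusedSectionVars false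

lemma ext_open {X : Type} [TopologicalSpace X] {k : ℕ} (hk : 1 ≤ k) {F : Set X}
    {g0 g : C(X, Esp k)} (hg0 : ∀ x ∈ F, ‖g0 x‖ = 1) (hg : ∀ x ∈ F, g x = g0 x) {V : Set X}
    (hV : IsOpen V) (hVg : ∀ x ∈ V, g x = 0) :
    IsOpen ({x | g x ≠ 0} ∪ V) ∧ ∃ hFU : F ⊆ {x | g x ≠ 0} ∪ V,
      ∃ f : C(↥({x | g x ≠ 0} ∪ V), Sph k), ∀ (x : X) (hx : x ∈ F), (f ⟨x, hFU hx⟩).1 = g0 x := by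
  have hO : IsOpen {x | g x ≠ 0} := isOpen_ne_fun g.continuous continuous_const
  have hFU : F ⊆ {x | g x ≠ 0} ∪ V := by
    intro x hx
    left
    have := hg0 x hx
    rw [mem_ofPred_eq, hg x hx]
    rintro h0
    simp [h0] at this
  refine ⟨hO.union hV, hFU, ?_⟩
  set U := {x | g x ≠ 0} ∪ V with hU
  let e0 : Esp k := EuclideanSpace.single ⟨0, hk⟩ 1
  have he0 : ‖e0‖ = 1 := by simp [e0]
  have hcont : Continuous fun x : U => if g x.1 = 0 then e0 else ‖g x.1‖⁻¹ • g x.1 := by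
    rw [continuous_iff_continuousAt]
    intro x
    by_cases hx : g x.1 = 0
    · have hxV : x.1 ∈ V := by
        rcases x.2 with h | h
        · exact absurd hx h
        · exact h
      refine (continuousAt_const (y := e0)).congr ?_
      filter_upwards [(hV.preimage continuous_subtype_val).mem_nhds hxV] with y hy
      rw [if_pos (hVg _ hy)]
    · have : ContinuousAt (fun x : U => ‖g x.1‖⁻¹ • g x.1) x := by
        have hc : ContinuousAt (fun x : U => g x.1) x := by fun_prop
        exact (hc.norm.inv₀ (norm_ne_zero_iff.2 hx)).smul hc
      refine this.congr ?_
      filter_upwards [(hO.preimage continuous_subtype_val).mem_nhds hx] with y hy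
      rw [if_neg hy]
  have hsph : ∀ x : U, (if g x.1 = 0 then e0 else ‖g x.1‖⁻¹ • g x.1) ∈
      Metric.sphere (0 : Esp k) 1 := by
    intro x
    rw [mem_sphere_zero_iff_norm]
    split_ifs with h
    · exact he0
    · have := norm_ne_zero_iff.2 h
      simp [norm_smul, this]
  refine ⟨⟨fun x => ⟨_, hsph x⟩, hcont.subtype_mk hsph⟩, ?_⟩
  intro x hx
  have h1 : ‖g x‖ = 1 := by rw [hg x hx, hg0 x hx]
  have h2 : g x ≠ 0 := fun h => by simp [h] at h1
  change (if g x = 0 then e0 else ‖g x‖⁻¹ • g x) = g0 x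
  rw [if_neg h2, h1, inv_one, one_smul, hg x hx]

section ZZ
variable {ι C : Type} [TopologicalSpace ι] [DiscreteTopology ι] [MetricSpace C] [CompactSpace C]
  [Nonempty C] {φ : ι → Set C}

lemma finlev_clopen {J : Set ι} (hJ : J.Finite) : IsClopen {z : ZZ φ | ∃ i ∈ J, lev z = i} := by
  have : {z : ZZ φ | ∃ i ∈ J, lev z = i} = ⋃ i ∈ J, {z : ZZ φ | lev z = i} := by
    ext z; simp
  rw [this]
  exact hJ.isClopen_biUnion fun i _ => level_clopen i

lemma lemmaE (hφ : ∀ i, φ i ∈ SFam C) {k : ℕ} (N : Fin k → Set C) (hN : ∀ c, SepSet (N c))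
    {F : Set (ZZ φ)} (hF : IsClosed F) (g0 : C(ZZ φ, Esp k)) (hg0 : ∀ z ∈ F, ‖g0 z‖ = 1) :
    ∃ J : Set ι, J.Finite ∧ ∃ g : C(ZZ φ, Esp k), (∀ z ∈ F, g z = g0 z) ∧
      (∀ z ∈ ZJ φ J, g z = 0 → ∀ c, z ∉ NZ φ (N c)) ∧
      ∀ (z : ZZ φ) (i : ι), lev z = i → i ∉ J → (g z = 0 ↔ g (mm φ (pr z)) = 0) := by
  have := zz_compact hφ
  obtain ⟨gm, hgm, hgm'⟩ := avoid N hN (hF.preimage mm_cont)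
    (g0.comp ⟨mm φ, mm_cont⟩) (fun x hx => hg0 _ hx)
  let O : Set (ZZ φ) := {z | 0 < inner ℝ (g0 z) (gm (pr z))}
  have hO : IsOpen O := isOpen_lt continuous_const
    (g0.continuous.inner (gm.continuous.comp pr_cont))
  let J : Set ι := {i | ∃ z ∈ F \ O, lev z = i}
  have hJ : J.Finite := by
    refine levels_finite hφ (hF.sdiff hO) ?_
    rintro z ⟨hzF, hzO⟩ hz
    apply hzO
    have hzF' := hzF
    rw [eq_mm hz] at hzF'
    have h1 := hgm (pr z) hzF'
    simp only [ContinuousMap.comp_apply, ContinuousMap.coe_mk] at h1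
    rw [← eq_mm hz] at h1
    simp only [O, mem_ofPred_eq]
    rw [h1, real_inner_self_eq_norm_sq, hg0 z hzF]
    norm_num
  have hJc := finlev_clopen (φ := φ) hJ
  obtain ⟨u, hu0, hu1, hu⟩ := exists_continuous_zero_one_of_isClosed
    (hF.inter hJc.compl.isClosed) hO.isClosed_compl (by
      rw [disjoint_left]
      rintro z ⟨hzF, hzJ⟩ hzO
      rcases lev_cases z with hz | ⟨i, hz⟩
      · have hzF' := hzF
        rw [eq_mm hz] at hzF'
        have h1 := hgm (pr z) hzF'
        simp only [ContinuousMap.comp_apply, ContinuousMap.coe_mk] at h1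
        rw [← eq_mm hz] at h1
        apply hzO
        simp only [O, mem_ofPred_eq]
        rw [h1, real_inner_self_eq_norm_sq, hg0 z hzF]
        norm_num
      · exact hzJ ⟨i, ⟨z, ⟨hzF, hzO⟩, hz⟩, hz⟩)
  let gh : C(ZZ φ, Esp k) := ⟨fun z => (1 - u z) • g0 z + u z • gm (pr z), by
    have := pr_cont (φ := φ); fun_prop⟩
  have hgh : ∀ z, gh z = 0 ↔ gm (pr z) = 0 := by
    intro z
    constructor
    · intro h0
      by_cases hzO : z ∈ O
      · have h1 : inner ℝ (gh z) (gm (pr z)) = 0 := by rw [h0, inner_zero_left]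
        simp only [gh, ContinuousMap.coe_mk, inner_add_left, real_inner_smul_left,
          real_inner_self_eq_norm_sq] at h1
        have h2 : 0 < inner ℝ (g0 z) (gm (pr z)) := hzO
        have h3 := (hu z).1
        have h4 := (hu z).2
        by_contra hne
        have h5 : 0 < ‖gm (pr z)‖ ^ 2 := by
          have := norm_pos_iff.2 hne
          positivity
        rcases h4.lt_or_eq with h4 | h4
        · have := mul_pos (sub_pos.2 h4) h2
          have := mul_nonneg h3 h5.le
          linarith
        · rw [h4] at h1; linarith
      · have h1 := hu1 hzO
        simp only [Pi.one_apply] at h1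
        simpa [gh, h1] using h0
    · intro h0
      have hzO : z ∉ O := by simp [O, h0]
      have h1 := hu1 hzO
      simp only [Pi.one_apply] at h1
      simp [gh, h1, h0]
  have hZJ := ZJ_closed (φ := φ) J
  have hZJc : CompactSpace (ZJ φ J) := isCompact_iff_compactSpace.1 hZJ.isCompact
  obtain ⟨gJ, hgJ, hgJ'⟩ := avoid (fun c => (Subtype.val ⁻¹' NZ φ (N c) : Set (ZJ φ J)))
    (fun c => NZ_sep hφ (hN c) hJ) (hF.preimage continuous_subtype_val)
    (g0.comp ⟨Subtype.val, continuous_subtype_val⟩) (fun x hx => hg0 _ hx)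
  obtain ⟨gK, hgK⟩ := ContinuousMap.exists_restrict_eq hZJ gJ
  have hgK' : ∀ z (hz : z ∈ ZJ φ J), gK z = gJ ⟨z, hz⟩ := fun z hz =>
    DFunLike.congr_fun hgK ⟨z, hz⟩
  have hin : ∀ z : ZZ φ, (∃ i ∈ J, lev z = i) → z ∈ ZJ φ J := by
    rintro z ⟨i, hi, hz⟩ j hj
    rw [hz, OnePoint.coe_eq_coe] at hj
    exact hj ▸ hi
  refine ⟨J, hJ, ⟨fun z => if ∃ i ∈ J, lev z = i then gK z else gh z, ?_⟩, ?_, ?_, ?_⟩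
  · refine continuous_if ?_ (by fun_prop) (by fun_prop)
    intro z hz
    rw [hJc.frontier_eq] at hz
    exact absurd hz (notMem_empty z)
  · intro z hz
    simp only [ContinuousMap.coe_mk]
    split_ifs with h
    · rw [hgK' z (hin z h)]
      exact hgJ ⟨z, hin z h⟩ hz
    · have h1 := hu0 ⟨hz, h⟩
      simp only [Pi.zero_apply] at h1
      simp [gh, h1]
  · intro z hz h0 c hc
    simp only [ContinuousMap.coe_mk] at h0
    split_ifs at h0 with h
    · rw [hgK' z hz] at h0
      exact hgJ' ⟨z, hz⟩ h0 c hc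
    · rcases lev_cases z with hl | ⟨i, hl⟩
      · exact hgm' _ ((hgh z).1 h0) c (hc.1 hl)
      · exact h ⟨i, hz i hl, hl⟩
  · intro z i hz hi
    have h1 : ¬ ∃ j ∈ J, lev z = j := by
      rintro ⟨j, hj, hj'⟩
      rw [hz, OnePoint.coe_eq_coe] at hj'
      exact hi (hj' ▸ hj)
    have h2 : ¬ ∃ j ∈ J, lev (mm φ (pr z)) = j := by
      rintro ⟨j, hj, hj'⟩
      simp at hj'
    simp only [ContinuousMap.coe_mk, if_neg h1, if_neg h2, hgh, pr_mm]

lemma QD_of_map (hφ : ∀ i, φ i ∈ SFam C) {a b : ℕ} {N : Fin (a + b) → Set C}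
    (hN : ∀ c, SepSet (N c)) (hc : ∀ x, ∃ c, x ∈ N c) {J : Set ι} (hJ : J.Finite)
    {Y : Type} [TopologicalSpace Y] [CompactSpace Y] {e : Y → ZZ φ} (he : Continuous e)
    (hinj : Function.Injective e) (hY : ∀ y, e y ∈ ZJ φ J)
    (hYN : ∀ y (c : Fin a), e y ∉ NZ φ (N (Fin.castAdd b c))) : QD Y b := by
  have he' : IsClosedEmbedding (fun y => (⟨e y, hY y⟩ : ZJ φ J)) :=
    (he.subtype_mk hY).isClosedEmbedding fun y y' h => hinj (congrArg Subtype.val h)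
  refine ⟨fun c => e ⁻¹' NZ φ (N (Fin.natAdd a c)), fun c => ?_, fun y => ?_⟩
  · exact (NZ_sep hφ (hN (Fin.natAdd a c)) hJ).comap he'
  · obtain ⟨c, hx⟩ := NZ_cover hc (e y)
    induction c using Fin.addCases with
    | left c => exact absurd hx (hYN y c)
    | right c => exact ⟨c, hx⟩

lemma zz_LInd_le (hφ : ∀ i, φ i ∈ SFam C) {k n : ℕ} (hk : 1 ≤ k)
    (hQ : QD C (k + k * (n + 1))) : LIndLE (Sph k) (ZZ φ) ((n + 2 : ℕ) : Ordinal.{0}) := by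
  have := zz_compact hφ
  obtain ⟨N, hN, hc⟩ := hQ
  choose xl hxl using fun i => sfam_lim (hφ i)
  refine LInd_crit fun F hF g0 hg0 => ?_
  obtain ⟨J, hJ, g, hg, hgN, hgm⟩ := lemmaE hφ (fun c => N (Fin.castAdd _ c)) (fun c => hN _)
    hF g0 hg0
  let V : Set (ZZ φ) := {z | g z = 0 ∧ ∃ i ∉ J, lev z = i ∧ pr z ≠ xl i}
  have hV : IsOpen V := by
    rw [isOpen_iff_mem_nhds]
    rintro z ⟨hz0, i, hi, hz, hne⟩
    have h1 := (iso_clopen (φ := φ) (hxl i (pr z) (pr_mem hz) hne)).isOpen.mem_nhds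
      (x := z) ⟨hz, rfl⟩
    filter_upwards [h1] with w hw
    refine ⟨?_, i, hi, hw.1, by rw [hw.2]; exact hne⟩
    rw [hgm w i hw.1 hi, hw.2, ← hgm z i hz hi]
    exact hz0
  obtain ⟨hU, hFU, f, hf⟩ := ext_open hk hg0 hg hV fun z hz => hz.1
  refine ⟨_, hU, hFU, ⟨f, hf⟩, Or.inr ⟨(n + 1 : ℕ), by exact_mod_cast Nat.lt_succ_self _, ?_⟩⟩
  set Z' := ({x | g x ≠ 0} ∪ V)ᶜ with hZ'
  have hZ'c : IsClosed Z' := hU.isClosed_compl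
  have hZ'0 : ∀ z ∈ Z', g z = 0 := fun z hz => by
    by_contra h
    exact hz (Or.inl h)
  have hZ'1 : ∀ z ∈ Z', ∀ i ∉ J, lev z = i → pr z = xl i := fun z hz i hi hl => by
    by_contra h
    exact hz (Or.inr ⟨hZ'0 z hz, i, hi, hl, h⟩)
  have : CompactSpace Z' := isCompact_iff_compactSpace.1 hZ'c.isCompact
  have hemb := hZ'c.isClosedEmbedding_subtypeVal
  refine LInd_crit fun F' hF' g0' hg0' => ?_
  obtain ⟨G0, hG0⟩ := ContinuousMap.exists_restrict_eq hZ'c g0'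
  have hG0' : ∀ z : Z', G0 z.1 = g0' z := fun z => DFunLike.congr_fun hG0 z
  obtain ⟨J', hJ', g', hg', hgN', hgm'⟩ := lemmaE hφ (fun c => N (Fin.castAdd _ c)) (fun c => hN _)
    (hemb.isClosedMap _ hF') G0 (by
      rintro _ ⟨z, hz, rfl⟩
      rw [hG0' z]; exact hg0' z hz)
  let gr : C(Z', Esp k) := g'.restrict Z'
  let V' : Set Z' := {z | gr z = 0 ∧ ∃ i ∉ J ∪ J', lev z.1 = i}
  have hV' : IsOpen V' := by
    rw [isOpen_iff_mem_nhds]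
    rintro z ⟨hz0, i, hi, hz⟩
    have h1 := ((level_clopen (φ := φ) i).isOpen.preimage
      (continuous_subtype_val (p := (· ∈ Z')))).mem_nhds (x := z) hz
    filter_upwards [h1] with w hw
    have hw' : lev w.1 = i := hw
    refine ⟨?_, i, hi, hw⟩
    have hi1 : i ∉ J := fun h => hi (Or.inl h)
    have hi2 : i ∉ J' := fun h => hi (Or.inr h)
    have hz0' : g' z.1 = 0 := hz0
    change g' w.1 = 0
    rw [hgm' w.1 i hw' hi2, hZ'1 w.1 w.2 i hi1 hw', ← hZ'1 z.1 z.2 i hi1 hz, ← hgm' z.1 i hz hi2]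
    exact hz0'
  obtain ⟨hU', hFU', f', hf'⟩ := ext_open hk (g := gr) hg0' (fun z hz => by
    rw [← hG0' z]; exact hg' z.1 ⟨z, hz, rfl⟩) hV' fun z hz => hz.1
  refine ⟨_, hU', hFU', ⟨f', hf'⟩, Or.inr ⟨n, by exact_mod_cast Nat.lt_succ_self _, ?_⟩⟩
  have hcl := hU'.isClosed_compl
  have : CompactSpace (↥({x | gr x ≠ 0} ∪ V')ᶜ) := isCompact_iff_compactSpace.1 hcl.isCompact
  refine QD.LInd n (QD_of_map hφ hN hc (hJ.union hJ') (e := fun y => y.1.1)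
    (continuous_subtype_val.comp continuous_subtype_val)
    (Subtype.val_injective.comp Subtype.val_injective) ?_ ?_)
  · intro y i hi
    by_contra hcon
    refine y.2 (Or.inr ⟨?_, i, hcon, hi⟩)
    by_contra h
    exact y.2 (Or.inl h)
  · intro y c
    have hg'0 : g' y.1.1 = 0 := by
      by_contra h
      exact y.2 (Or.inl h)
    by_cases hl : y.1.1 ∈ ZJ φ J
    · exact hgN _ hl (hZ'0 _ y.1.2) c
    · refine hgN' _ ?_ hg'0 c
      intro i hi
      by_contra hcon
      apply hl
      intro j hj
      rw [hi, OnePoint.coe_eq_coe] at hj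
      subst hj
      by_contra hij
      refine y.2 (Or.inr ⟨hg'0, i, ?_, hi⟩)
      rintro (h | h)
      · exact hij h
      · exact hcon h

end ZZ

set_option linter.unusedSectionVars false

lemma kOne {X : Type} [TopologicalSpace X] [NormalSpace X] {ν : Type} [Finite ν]
    (F : ν → Set X) (hF : ∀ m, IsClosed (F m)) (hFe : ∀ x, ∃ m, x ∉ F m) {N : Set X}
    (hN : SepSet N) (b : ν) :
    ∃ h : ν → C(X, ℝ), (∀ m, ∀ x ∈ F m, h m x < 0) ∧ (∀ x, ∃ m, 0 < h m x) ∧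
      ∀ x ∈ N, h b x ≠ 0 := by
  obtain ⟨U, hU, hFU, hUe⟩ := swell F hF hFe
  have key : ∀ m, ∃ h : C(X, ℝ), (∀ x ∈ F m, h x < 0) ∧ (∀ x ∈ (U m)ᶜ, 0 < h x) ∧
      (m = b → ∀ x ∈ N, h x ≠ 0) := by
    intro m
    have hd : Disjoint (F m) (U m)ᶜ := disjoint_compl_right_iff_subset.2 (hFU m)
    by_cases hm : m = b
    · obtain ⟨h, h1, h2, h3⟩ := hN _ _ (hF m) (hU m).isClosed_compl hd
      exact ⟨h, h1, h2, fun _ => h3⟩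
    · obtain ⟨h, h1, h2, h3⟩ := SepSet.empty _ _ (hF m) (hU m).isClosed_compl hd
      exact ⟨h, h1, h2, fun h => absurd h hm⟩
  choose h h1 h2 h3 using key
  refine ⟨h, h1, fun x => ?_, h3 b rfl⟩
  obtain ⟨m, hm⟩ := hUe x
  exact ⟨m, h2 m x hm⟩

def UU {X ν : Type} [TopologicalSpace X] (h : ν → C(X, ℝ)) (a b m : ν) : Set X :=
  {x | h m x < 0 ∨ (m = a ∧ 0 < h b x)}

lemma UU_open {X ν : Type} [TopologicalSpace X] (h : ν → C(X, ℝ)) (a b m : ν) :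
    IsOpen (UU h a b m) := by
  have : UU h a b m = {x | h m x < 0} ∪ {x | m = a ∧ 0 < h b x} := rfl
  rw [this]
  refine (isOpen_lt (h m).continuous continuous_const).union ?_
  exact isOpen_const.inter (isOpen_lt continuous_const (h b).continuous)

lemma UU_empty {X ν : Type} [TopologicalSpace X] {h : ν → C(X, ℝ)} {a b : ν} (hab : a ≠ b)
    (hh : ∀ x, ∃ m, 0 < h m x) (x : X) : ∃ m, x ∉ UU h a b m := by
  by_contra hcon
  push Not at hcon
  obtain ⟨m, hm⟩ := hh x
  have hb : h b x < 0 := (hcon b).resolve_right fun h => hab h.1.symm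
  rcases hcon m with h1 | h1
  · linarith
  · linarith [h1.2]

lemma UU_compl {X ν : Type} [TopologicalSpace X] {h : ν → C(X, ℝ)} {a b : ν}
    {x : X} (hx : ∀ m, x ∉ UU h a b m) : h b x = 0 := by
  refine le_antisymm ?_ ?_
  · by_contra hc
    exact hx a (Or.inr ⟨rfl, not_le.1 hc⟩)
  · by_contra hc
    exact hx b (Or.inl (not_le.1 hc))

section ZZ
variable {ι C : Type} [TopologicalSpace ι] [DiscreteTopology ι] [MetricSpace C] [CompactSpace C]
  [Nonempty C] {φ : ι → Set C}

lemma zz_KPart (hφ : ∀ i, φ i ∈ SFam C) {ν : Type} [Finite ν] {a b c : ν} (hab : a ≠ b)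
    (hac : a ≠ c) (hbc : b ≠ c) {N : Set C} (hN : SepSet N) (F : ν → Set (ZZ φ))
    (hF : ∀ m, IsClosed (F m)) (hFe : ∀ z, ∃ m, z ∉ F m) :
    ∃ J : Set ι, J.Finite ∧ ∃ V : ν → Set (ZZ φ), (∀ m, IsOpen (V m)) ∧ (∀ m, F m ⊆ V m) ∧
      (∀ z, ∃ m, z ∉ V m) ∧ ∀ z, (∀ m, z ∉ V m) → z ∈ ZJ φ J ∧ z ∉ NZ φ N := by
  have := zz_compact hφ
  choose xl hxl using fun i => sfam_lim (hφ i)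
  obtain ⟨h, h1, h2, h3⟩ := kOne (fun m => mm φ ⁻¹' F m) (fun m => (hF m).preimage mm_cont)
    (fun x => hFe (mm φ x)) hN b
  let K : Set (ZZ φ) := ⋃ m, F m ∩ {z | 0 ≤ h m (pr z)}
  have hK : IsClosed K := isClosed_iUnion_of_finite fun m =>
    (hF m).inter (isClosed_le continuous_const ((h m).continuous.comp pr_cont))
  have hKm : ∀ z ∈ K, lev z ≠ OnePoint.infty := by
    intro z hz hl
    obtain ⟨m, hm, hm'⟩ := mem_iUnion.1 hz
    rw [eq_mm hl] at hm
    exact absurd hm' (not_le.2 (h1 m (pr z) hm))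
  let J : Set ι := {i | ∃ z ∈ K, lev z = i}
  have hJ : J.Finite := levels_finite hφ hK hKm
  have hJc := finlev_clopen (φ := φ) hJ
  set JL : Set (ZZ φ) := {z | ∃ i ∈ J, lev z = i} with hJL
  have hin : ∀ z ∈ JL, z ∈ ZJ φ J := by
    rintro z ⟨i, hi, hz⟩ j hj
    rw [hz, OnePoint.coe_eq_coe] at hj
    exact hj ▸ hi
  have hZJ := ZJ_closed (φ := φ) J
  have hZJc : CompactSpace (ZJ φ J) := isCompact_iff_compactSpace.1 hZJ.isCompact
  obtain ⟨h', h1', h2', h3'⟩ := kOne (fun m => (Subtype.val ⁻¹' F m : Set (ZJ φ J)))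
    (fun m => (hF m).preimage continuous_subtype_val) (fun x => hFe x.1) (NZ_sep hφ hN hJ) b
  choose p hp using fun i => h2 (xl i)
  let r : ι → ν := fun i => if p i = a then c else a
  have hrb : ∀ i, r i ≠ b := by
    intro i; dsimp only [r]; split_ifs
    · exact hbc.symm
    · exact hab
  have hrp : ∀ i, p i ≠ r i := by
    intro i; dsimp only [r]; split_ifs with hh
    · rw [hh]; exact hac
    · exact hh
  let E : ι → Set C := fun i => {x | 0 < h (p i) x ∨ ∀ m, x ∉ UU h a b m}
  let V1 : ν → Set (ZZ φ) := fun m => JLᶜ ∩ pr ⁻¹' UU h a b m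
  let V2 : ν → Set (ZZ φ) := fun m => {z | z ∈ JL ∧ ∃ hz : z ∈ ZJ φ J, (⟨z, hz⟩ : ZJ φ J) ∈ UU h' a b m}
  let V3 : ν → Set (ZZ φ) := fun m => {z | ∃ i ∉ J, lev z = i ∧ r i = m ∧ pr z ∈ E i}
  have hV1 : ∀ m, IsOpen (V1 m) := fun m =>
    hJc.compl.isOpen.inter ((UU_open h a b m).preimage pr_cont)
  have hV2 : ∀ m, IsOpen (V2 m) := by
    intro m
    obtain ⟨O, hO, hO'⟩ := isOpen_induced_iff.1 (UU_open h' a b m)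
    have : V2 m = JL ∩ O := by
      ext z
      constructor
      · rintro ⟨hz, hz', hzU⟩
        rw [← hO'] at hzU
        exact ⟨hz, hzU⟩
      · rintro ⟨hz, hzO⟩
        refine ⟨hz, hin z hz, ?_⟩
        rw [← hO']
        exact hzO
    rw [this]
    exact hJc.isOpen.inter hO
  have hV3 : ∀ m, IsOpen (V3 m) := by
    intro m
    rw [isOpen_iff_mem_nhds]
    rintro z ⟨i, hi, hz, hm, hE⟩
    by_cases hx : pr z = xl i
    · have hlt : 0 < h (p i) (pr z) := by rw [hx]; exact hp i
      have e1 := (level_clopen (φ := φ) i).isOpen.mem_nhds (x := z) hz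
      have e2 := (isOpen_lt continuous_const ((h (p i)).continuous.comp
        (pr_cont (φ := φ)))).mem_nhds (x := z) hlt
      filter_upwards [e1, e2] with w hw hw'
      exact ⟨i, hi, hw, hm, Or.inl hw'⟩
    · have e1 := (iso_clopen (φ := φ) (hxl i (pr z) (pr_mem hz) hx)).isOpen.mem_nhds
        (x := z) ⟨hz, rfl⟩
      filter_upwards [e1] with w hw
      exact ⟨i, hi, hw.1, hm, by rw [hw.2]; exact hE⟩
  refine ⟨J, hJ, fun m => V1 m ∪ V2 m ∪ V3 m, fun m => ((hV1 m).union (hV2 m)).union (hV3 m),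
    ?_, ?_, ?_⟩
  · intro m z hz
    left
    by_cases hzJ : z ∈ JL
    · right
      exact ⟨hzJ, hin z hzJ, Or.inl (h1' m ⟨z, hin z hzJ⟩ hz)⟩
    · left
      refine ⟨hzJ, Or.inl ?_⟩
      by_contra hc
      have hzK : z ∈ K := mem_iUnion.2 ⟨m, hz, not_lt.1 hc⟩
      rcases lev_cases z with hl | ⟨i, hl⟩
      · exact hKm z hzK hl
      · exact hzJ ⟨i, ⟨z, hzK, hl⟩, hl⟩
  · intro z
    by_contra hcon
    push Not at hcon
    by_cases hzJ : z ∈ JL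
    · obtain ⟨m, hm⟩ := UU_empty hab h2' ⟨z, hin z hzJ⟩
      rcases hcon m with (hc | hc) | hc
      · exact hc.1 hzJ
      · obtain ⟨_, _, hc⟩ := hc
        exact hm hc
      · obtain ⟨i, hi, hl, _⟩ := hc
        exact hi (hin z hzJ i hl)
    · have hcon' : ∀ m, pr z ∈ UU h a b m ∨ z ∈ V3 m := by
        intro m
        rcases hcon m with (hc | hc) | hc
        · exact Or.inl hc.2
        · exact absurd hc.1 hzJ
        · exact Or.inr hc
      obtain ⟨m, hm⟩ := UU_empty hab h2 (pr z)
      obtain ⟨i, hi, hl, hri, hE⟩ := (hcon' m).resolve_left hm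
      have huniq : ∀ m', m' ≠ r i → pr z ∈ UU h a b m' := by
        intro m' hm'
        refine (hcon' m').resolve_right ?_
        rintro ⟨j, hj, hlj, hrj, _⟩
        rw [hl, OnePoint.coe_eq_coe] at hlj
        subst hlj
        exact hm' hrj.symm
      have hb : h b (pr z) < 0 := (huniq b (hrb i).symm).resolve_right fun h => hab h.1.symm
      have hpz : h (p i) (pr z) < 0 := (huniq (p i) (hrp i)).resolve_right fun h => by
        linarith [h.2]
      rcases hE with hE | hE
      · linarith
      · exact hE b (Or.inl hb)
  · intro z hz
    have hz1 : ∀ m, z ∉ V1 m := fun m hh => hz m (Or.inl (Or.inl hh))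
    have hz2 : ∀ m, z ∉ V2 m := fun m hh => hz m (Or.inl (Or.inr hh))
    have hz3 : ∀ m, z ∉ V3 m := fun m hh => hz m (Or.inr hh)
    have hzz : z ∈ ZJ φ J := by
      intro i hl
      by_contra hi
      have hzJ : z ∉ JL := fun hh => hi (hin z hh i hl)
      exact hz3 (r i) ⟨i, hi, hl, rfl, Or.inr fun m hm => hz1 m ⟨hzJ, hm⟩⟩
    refine ⟨hzz, fun hNZ => ?_⟩
    by_cases hzJ : z ∈ JL
    · exact h3' ⟨z, hzz⟩ hNZ (UU_compl (a := a) (b := b) fun m hm => hz2 m ⟨hzJ, hzz, hm⟩)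
    · rcases lev_cases z with hl | ⟨i, hl⟩
      · exact h3 (pr z) (hNZ.1 hl) (UU_compl (a := a) (b := b) fun m hm => hz1 m ⟨hzJ, hm⟩)
      · exact hzJ ⟨i, hzz i hl, hl⟩

lemma zz_KInd_le (hφ : ∀ i, φ i ∈ SFam C) {k n : ℕ} (hk : 2 ≤ k)
    (hQ : QD C (1 + k * (n + 1))) : KIndLE (bComplex k) (ZZ φ) ((n + 1 : ℕ) : Ordinal.{0}) := by
  have := zz_compact hφ
  obtain ⟨N, hN, hc⟩ := hQ
  rw [KIndLE_iff]
  intro F hF hFt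
  obtain ⟨J, hJ, V, hV, hFV, hVe, hVc⟩ := zz_KPart hφ (a := (⟨0, by omega⟩ : Fin (k + 1)))
    (b := ⟨1, by omega⟩) (c := ⟨2, by omega⟩) (by simp) (by simp) (by simp)
    (hN (Fin.castAdd _ 0)) F hF (isKTuple_b.1 hFt)
  refine ⟨V, hV, isKTuple_b.2 hVe, hFV, Or.inr ⟨n, by exact_mod_cast Nat.lt_succ_self _, ?_⟩⟩
  have hcl : IsClosed (⋃ i, V i)ᶜ := (isOpen_iUnion hV).isClosed_compl
  have : CompactSpace (↥(⋃ i, V i)ᶜ) := isCompact_iff_compactSpace.1 hcl.isCompact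
  have hout : ∀ y : ↥(⋃ i, V i)ᶜ, ∀ m, y.1 ∉ V m := fun y m hm => y.2 (mem_iUnion.2 ⟨m, hm⟩)
  refine LIndLE.toK _ (QD.LInd n (QD_of_map hφ hN hc hJ (e := fun y => y.1)
    continuous_subtype_val Subtype.val_injective (fun y => (hVc _ (hout y)).1) ?_))
  intro y c
  rw [Fin.eq_zero c]
  exact (hVc _ (hout y)).2

end ZZ

set_option linter.unusedSectionVars false

lemma glueL {L : Type} [MetricSpace L] [CompactSpace L] {X : Type} [TopologicalSpace X]
    {α : Ordinal.{0}} {U : Set X} (hU : IsOpen U)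
    (γ : X → L) (hγ : ContinuousOn γ U)
    (hlim : ∀ x ∈ closure U, ∃ l, Filter.Tendsto γ (𝓝[U] x) (𝓝 l))
    (hP : LIndLE L (↥Uᶜ) α) :
    ∃ U' : Set X, IsOpen U' ∧ U ⊆ U' ∧ (∃ γ' : X → L, ContinuousOn γ' U' ∧ ∀ x ∈ U, γ' x = γ x) ∧
      (U'ᶜ = ∅ ∨ ∃ β < α, LIndLE L (↥U'ᶜ) β) := by
  by_cases hne : Nonempty X
  swap
  · refine ⟨U, hU, Subset.rfl, ⟨γ, hγ, fun _ _ => rfl⟩, Or.inl ?_⟩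
    rw [eq_empty_iff_forall_notMem]
    exact fun x _ => hne ⟨x⟩
  have : Nonempty L := hne.map γ
  set G := extendFrom U γ with hG
  have hGc : ContinuousOn G (closure U) := continuousOn_extendFrom Subset.rfl hlim
  have hGU : ∀ x ∈ U, G x = γ x := extendFrom_extends hγ
  rw [LIndLE_iff] at hP
  have hD : IsClosed (Subtype.val ⁻¹' closure U : Set (↥Uᶜ)) :=
    isClosed_closure.preimage continuous_subtype_val
  obtain ⟨W, hW, hDW, ⟨g2, hg2⟩, hdim⟩ := hP _ hD
    ⟨fun x => G x.1.1, hGc.comp_continuous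
      (continuous_subtype_val.comp continuous_subtype_val) fun x => x.2⟩
  let g2' : X → L := fun x => if h : ∃ hx : x ∈ Uᶜ, (⟨x, hx⟩ : ↥Uᶜ) ∈ W then
    g2 ⟨⟨x, h.1⟩, h.2⟩ else γ x
  have hg2' : ∀ (x : X) (hx : x ∈ Uᶜ) (hxW : (⟨x, hx⟩ : ↥Uᶜ) ∈ W),
      g2' x = g2 ⟨⟨x, hx⟩, hxW⟩ := fun x hx hxW => dif_pos ⟨hx, hxW⟩
  have hcompl : (U ∪ Subtype.val '' W)ᶜ = Subtype.val '' Wᶜ := by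
    ext x
    constructor
    · intro hx
      have hxU : x ∈ Uᶜ := fun h => hx (Or.inl h)
      exact ⟨⟨x, hxU⟩, fun h => hx (Or.inr ⟨_, h, rfl⟩), rfl⟩
    · rintro ⟨y, hy, rfl⟩ (h | ⟨y', hy', he⟩)
      · exact y.2 h
      · exact hy (Subtype.val_injective he ▸ hy')
  have hU' : IsOpen (U ∪ Subtype.val '' W) := by
    rw [← isClosed_compl_iff, hcompl]
    exact hU.isClosed_compl.isClosedEmbedding_subtypeVal.isClosedMap _ hW.isClosed_compl
  refine ⟨U ∪ Subtype.val '' W, hU', subset_union_left, ?_, ?_⟩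
  · refine ⟨fun x => if x ∈ closure U then G x else g2' x, ?_, fun x hx => ?_⟩
    · rw [continuousOn_iff_continuous_domRestrict]
      set T := (U ∪ Subtype.val '' W : Set X)
      let A : Set T := Subtype.val ⁻¹' closure U
      let B : Set T := Subtype.val ⁻¹' Uᶜ
      have hA : IsClosed A := isClosed_closure.preimage continuous_subtype_val
      have hB : IsClosed B := hU.isClosed_compl.preimage continuous_subtype_val
      have hAB : A ∪ B = Set.univ := by
        rw [eq_univ_iff_forall]
        intro x
        by_cases h : x.1 ∈ U
        · exact Or.inl (subset_closure h)
        · exact Or.inr h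
      rw [← continuousOn_univ, ← hAB]
      have hBW : ∀ x : T, x ∈ B → ∃ hx : x.1 ∈ Uᶜ, (⟨x.1, hx⟩ : ↥Uᶜ) ∈ W := by
        rintro ⟨x, hx | ⟨y, hy, rfl⟩⟩ hxB
        · exact absurd hx hxB
        · exact ⟨y.2, hy⟩
      refine ContinuousOn.union_of_isClosed ?_ ?_ hA hB
      · have h1 : ContinuousOn (fun x : T => G x.1) A :=
          hGc.comp continuous_subtype_val.continuousOn fun x hx => hx
        refine h1.congr fun x hx => ?_
        exact if_pos hx
      · have h1 : ContinuousOn (fun x : T => g2' x.1) B := by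
          rw [continuousOn_iff_continuous_domRestrict]
          have : B.domRestrict (fun x : T => g2' x.1) = fun x : B =>
              g2 ⟨⟨x.1.1, (hBW x.1 x.2).1⟩, (hBW x.1 x.2).2⟩ := by
            funext x
            exact hg2' _ _ _
          rw [this]
          exact g2.continuous.comp (((continuous_subtype_val.comp
            continuous_subtype_val).subtype_mk _).subtype_mk _)
        refine h1.congr fun x hx => ?_
        change (if x.1 ∈ closure U then G x.1 else g2' x.1) = g2' x.1
        split_ifs with h
        · obtain ⟨hx1, hx2⟩ := hBW x hx
          rw [hg2' _ hx1 hx2]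
          exact (hg2 ⟨x.1, hx1⟩ h).symm
        · rfl
    · dsimp only
      rw [if_pos (subset_closure hx), hGU x hx]
  · rcases hdim with h | ⟨β, hβ, h⟩
    · left
      rw [hcompl, h, image_empty]
    · right
      refine ⟨β, hβ, ?_⟩
      have hmem : ∀ y : ↥(U ∪ Subtype.val '' W)ᶜ, ∃ hx : y.1 ∈ Uᶜ, (⟨y.1, hx⟩ : ↥Uᶜ) ∈ Wᶜ :=
        fun y => ⟨fun h => y.2 (Or.inl h), fun h => y.2 (Or.inr ⟨_, h, rfl⟩)⟩
      refine LIndLE_closedEmb β (fun y => ⟨⟨y.1, (hmem y).1⟩, (hmem y).2⟩) ?_ h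
      have e1 : IsClosedEmbedding (fun y : ↥Wᶜ => (y.1.1 : X)) :=
        hU.isClosed_compl.isClosedEmbedding_subtypeVal.comp
          hW.isClosed_compl.isClosedEmbedding_subtypeVal
      have e2 := hU'.isClosed_compl.isClosedEmbedding_subtypeVal
      exact IsClosedEmbedding.of_comp_iff e1 |>.1 e2

lemma seq_sfam {C : Type} [MetricSpace C] {R : Set C} {x0 : C} (hinf : R.Infinite)
    (hcount : R.Countable) (hx0 : x0 ∉ R) (hlim : ∀ O ∈ 𝓝 x0, (R \ O).Finite) :
    insert x0 R ∈ SFam C := by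
  right
  have := hcount.to_subtype
  have := hinf.to_subtype
  obtain ⟨e⟩ := nonempty_equiv_of_countable (α := ℕ) (β := R)
  let f : OnePoint ℕ → C := fun a => a.elim x0 (fun s => (e s).1)
  have hf : Continuous f := by
    rw [OnePoint.continuous_iff_from_nat]
    change Filter.Tendsto (fun s : ℕ => (e s).1) Filter.atTop (𝓝 x0)
    rw [← Nat.cofinite_eq_atTop]
    intro O hO
    rw [Filter.mem_map, Filter.mem_cofinite]
    refine ((hlim O hO).preimage (f := fun s => (e s).1)
      (Subtype.val_injective.comp e.injective).injOn).subset ?_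
    intro s hs
    exact ⟨(e s).2, hs⟩
  have hinj : Function.Injective f := by
    intro a b hab
    induction a using OnePoint.rec with
    | infty =>
      induction b using OnePoint.rec with
      | infty => rfl
      | coe b => exact absurd ((show x0 = (e b).1 from hab) ▸ (e b).2) hx0
    | coe a =>
      induction b using OnePoint.rec with
      | infty => exact absurd ((show (e a).1 = x0 from hab) ▸ (e a).2) hx0
      | coe b => exact congrArg _ (e.injective (Subtype.val_injective (show (e a).1 = (e b).1 from hab)))
  have hr : range f = insert x0 R := by
    ext x
    constructor
    · rintro ⟨a, rfl⟩
      induction a using OnePoint.rec with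
      | infty => exact Or.inl rfl
      | coe a => exact Or.inr (e a).2
    · rintro (rfl | hx)
      · exact ⟨OnePoint.infty, rfl⟩
      · refine ⟨((e.symm ⟨x, hx⟩ : ℕ) : OnePoint ℕ), ?_⟩
        change (e (e.symm ⟨x, hx⟩)).1 = x
        simp
  rw [← hr]
  exact ⟨(hf.isClosedEmbedding hinj).isEmbedding.toHomeomorph.symm⟩

lemma aleph_le_tWeight {C : Type} [TopologicalSpace C] [T2Space C] [Infinite C] : ℵ₀ ≤ tWeight C := by
  refine le_csInf ⟨_, _, TopologicalSpace.isTopologicalBasis_opens, rfl⟩ ?_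
  rintro _ ⟨B, hB, rfl⟩
  by_contra hlt
  have hfin : Finite B := Cardinal.lt_aleph0_iff_finite.1 (not_le.1 hlt)
  have : Function.Injective (fun x : C => {b : B | x ∈ b.1}) := by
    intro x y hxy
    by_contra hne
    obtain ⟨b, hb, hxb, hsub⟩ := hB.exists_subset_of_mem_open
      (show x ∈ ({y}ᶜ : Set C) from hne) isOpen_compl_singleton
    have h1 : (⟨b, hb⟩ : B) ∈ {b : B | y ∈ b.1} := by
      have : (⟨b, hb⟩ : B) ∈ {b : B | x ∈ b.1} := hxb
      exact (show {b : B | x ∈ b.1} = {b : B | y ∈ b.1} from hxy) ▸ this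
    exact hsub h1 rfl
  have := Finite.of_injective _ this
  exact not_finite C

section ZZ
variable {ι C : Type} [TopologicalSpace ι] [DiscreteTopology ι] [MetricSpace C] [CompactSpace C]
  [Nonempty C] {φ : ι → Set C}

lemma bad_finite (hφ : ∀ i, φ i ∈ SFam C) {O : Set (ZZ φ)} {x : C} (hO : O ∈ 𝓝 (mm φ x)) :
    {i : ι | ∃ z : ZZ φ, lev z = i ∧ pr z = x ∧ z ∉ O}.Finite := by
  rw [zz_nhds_inf hφ (by simp), Filter.mem_inf_iff] at hO
  obtain ⟨A, ⟨A', hA', hA⟩, B, ⟨B', hB', hB⟩, rfl⟩ := hO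
  refine (one_nhds_inf hA').subset ?_
  rintro i ⟨z, hz, hx, hzO⟩ hi
  refine hzO ⟨hA (by rw [mem_preimage, hz]; exact hi), hB ?_⟩
  rw [pr_mm] at hB'
  rw [mem_preimage, hx]
  exact mem_of_mem_nhds hB'

lemma zz_key (hφ : ZPhiOK φ) (hι : tWeight C < #ι) {L : Type} [MetricSpace L] [CompactSpace L]
    {U : Set (ZZ φ)} (hU : IsOpen U) (Γ : ZZ φ → L) (hΓ : ContinuousOn Γ U) {x0 : C}
    (hx0 : x0 ∈ closure (mm φ ⁻¹' U))
    (hno : ¬ ∃ l, Filter.Tendsto (fun x => Γ (mm φ x)) (𝓝[mm φ ⁻¹' U] x0) (𝓝 l)) :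
    ∃ (i : ι) (s : φ i), ∀ y, pt φ i s y ∉ U := by
  set V := mm φ ⁻¹' U with hV
  have hVo : IsOpen V := hU.preimage mm_cont
  have hγ : ContinuousOn (fun x => Γ (mm φ x)) V := hΓ.comp mm_cont.continuousOn fun x hx => hx
  have hx0V : x0 ∉ V := fun h => hno ⟨_, hγ x0 h⟩
  have hnb : (𝓝[V] x0).NeBot := mem_closure_iff_nhdsWithin_neBot.1 hx0
  rw [← cauchy_map_iff_exists_tendsto, Metric.cauchy_iff] at hno
  push Not at hno
  obtain ⟨ε, hε, hno⟩ := hno inferInstance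
  have hpair : ∀ s : ℕ, ∃ p : C × C, p.1 ∈ V ∧ p.2 ∈ V ∧ dist p.1 x0 < 1 / ((s : ℝ) + 1) ∧
      dist p.2 x0 < 1 / ((s : ℝ) + 1) ∧ ε ≤ dist (Γ (mm φ p.1)) (Γ (mm φ p.2)) := by
    intro s
    have hmem : Metric.ball x0 (1 / ((s : ℝ) + 1)) ∩ V ∈ 𝓝[V] x0 :=
      Filter.inter_mem (mem_nhdsWithin_of_mem_nhds (Metric.ball_mem_nhds _ (by positivity)))
        self_mem_nhdsWithin
    obtain ⟨_, ⟨x, hx, rfl⟩, _, ⟨y, hy, rfl⟩, hd⟩ := hno _ (Filter.image_mem_map hmem)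
    exact ⟨(x, y), hx.2, hy.2, hx.1, hy.1, hd⟩
  choose p hp1 hp2 hd1 hd2 hdist using hpair
  have ht : Filter.Tendsto (fun s : ℕ => 1 / ((s : ℝ) + 1)) Filter.atTop (𝓝 0) :=
    tendsto_one_div_add_atTop_nhds_zero_nat
  have hl1 : Filter.Tendsto (fun s => (p s).1) Filter.atTop (𝓝 x0) :=
    tendsto_iff_dist_tendsto_zero.2 (squeeze_zero (fun _ => dist_nonneg) (fun s => (hd1 s).le) ht)
  have hl2 : Filter.Tendsto (fun s => (p s).2) Filter.atTop (𝓝 x0) :=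
    tendsto_iff_dist_tendsto_zero.2 (squeeze_zero (fun _ => dist_nonneg) (fun s => (hd2 s).le) ht)
  set R : Set C := range (fun s => (p s).1) ∪ range (fun s => (p s).2) with hR
  have hRV : R ⊆ V := by
    rintro x (⟨s, rfl⟩ | ⟨s, rfl⟩)
    · exact hp1 s
    · exact hp2 s
  have hRc : R.Countable := (countable_range _).union (countable_range _)
  have hxR : x0 ∉ R := fun h => hx0V (hRV h)
  have hRinf : R.Infinite := by
    intro hfin
    have h1 : Rᶜ ∈ 𝓝 x0 := hfin.isClosed.isOpen_compl.mem_nhds hxR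
    obtain ⟨s, hs⟩ := (hl1.eventually h1).exists
    exact hs (Or.inl ⟨s, rfl⟩)
  have hRlim : ∀ O ∈ 𝓝 x0, (R \ O).Finite := by
    intro O hO
    have h1 := hl1.eventually hO
    have h2 := hl2.eventually hO
    rw [← Nat.cofinite_eq_atTop, Filter.eventually_cofinite] at h1 h2
    refine ((h1.image fun s => (p s).1).union (h2.image fun s => (p s).2)).subset ?_
    rintro x ⟨⟨s, rfl⟩ | ⟨s, rfl⟩, hx⟩
    · exact Or.inl ⟨s, hx, rfl⟩
    · exact Or.inr ⟨s, hx, rfl⟩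
  have hS := seq_sfam hRinf hRc hxR hRlim
  have hCinf : Infinite C := hRinf.to_subtype.of_injective _ Subtype.val_injective
  let O : C → Set (ZZ φ) := fun x => {z | z ∈ U ∧ dist (Γ z) (Γ (mm φ x)) < ε / 4}
  have hO : ∀ x ∈ V, O x ∈ 𝓝 (mm φ x) := by
    intro x hx
    have h1 : U ∈ 𝓝 (mm φ x) := hU.mem_nhds hx
    have h2 : ContinuousAt Γ (mm φ x) := hΓ.continuousAt h1
    filter_upwards [h1, h2 (Metric.ball_mem_nhds _ (by positivity : 0 < ε / 4))] with z hz hz'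
    exact ⟨hz, hz'⟩
  have hbad : (⋃ x ∈ R, {i : ι | ∃ z : ZZ φ, lev z = i ∧ pr z = x ∧ z ∉ O x}).Countable :=
    hRc.biUnion fun x hx => (bad_finite hφ.1 (hO x (hRV hx))).countable
  have hunc : ¬ (φ ⁻¹' {insert x0 R}).Countable := by
    intro hc
    have h1 := Cardinal.le_aleph0_iff_set_countable.2 hc
    rw [hφ.2 _ hS] at h1
    exact absurd (aleph_le_tWeight (C := C)) (not_le.2 (hι.trans_le h1))
  obtain ⟨i, hi, hib⟩ : ∃ i ∈ φ ⁻¹' {insert x0 R},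
      i ∉ ⋃ x ∈ R, {i : ι | ∃ z : ZZ φ, lev z = i ∧ pr z = x ∧ z ∉ O x} := by
    by_contra hcon
    push Not at hcon
    exact hunc (hbad.mono hcon)
  have hi' : φ i = insert x0 R := hi
  have hRi : ∀ x ∈ R, x ∈ φ i := fun x hx => hi' ▸ Or.inr hx
  have hx0i : x0 ∈ φ i := hi' ▸ Or.inl rfl
  have hgood : ∀ x (hx : x ∈ R) y, pt φ i ⟨x, hRi x hx⟩ y ∈ O x := by
    intro x hx y
    by_contra hcon
    exact hib (mem_biUnion hx ⟨_, lev_pt _ _ _, pr_pt _ _ _, hcon⟩)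
  refine ⟨i, ⟨x0, hx0i⟩, fun y hy => ?_⟩
  have hcΓ : ContinuousAt Γ (pt φ i ⟨x0, hx0i⟩ y) := hΓ.continuousAt (hU.mem_nhds hy)
  have hcpt : Continuous fun s : φ i => pt φ i s y :=
    (pt_cont i).comp (continuous_id.prodMk continuous_const)
  have hcomp : ContinuousAt (fun s : φ i => Γ (pt φ i s y)) ⟨x0, hx0i⟩ :=
    ContinuousAt.comp (f := fun s : φ i => pt φ i s y) hcΓ hcpt.continuousAt
  have hm1 : ∀ s, (p s).1 ∈ R := fun s => Or.inl ⟨s, rfl⟩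
  have hm2 : ∀ s, (p s).2 ∈ R := fun s => Or.inr ⟨s, rfl⟩
  have ht1 : Filter.Tendsto (fun s => (⟨(p s).1, hRi _ (hm1 s)⟩ : φ i)) Filter.atTop
      (𝓝 ⟨x0, hx0i⟩) := tendsto_subtype_rng.2 hl1
  have ht2 : Filter.Tendsto (fun s => (⟨(p s).2, hRi _ (hm2 s)⟩ : φ i)) Filter.atTop
      (𝓝 ⟨x0, hx0i⟩) := tendsto_subtype_rng.2 hl2
  have hball := Metric.ball_mem_nhds (Γ (pt φ i ⟨x0, hx0i⟩ y)) (by positivity : 0 < ε / 4)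
  obtain ⟨s, hs1, hs2⟩ := (((hcomp.tendsto.comp ht1).eventually hball).and
    ((hcomp.tendsto.comp ht2).eventually hball)).exists
  have e1 := (hgood _ (hm1 s) y).2
  have e2 := (hgood _ (hm2 s) y).2
  have e3 : dist (Γ (pt φ i ⟨(p s).1, hRi _ (hm1 s)⟩ y)) (Γ (pt φ i ⟨x0, hx0i⟩ y)) < ε / 4 := hs1
  have e4 : dist (Γ (pt φ i ⟨(p s).2, hRi _ (hm2 s)⟩ y)) (Γ (pt φ i ⟨x0, hx0i⟩ y)) < ε / 4 := hs2
  have e5 := hdist s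
  have t1 := dist_triangle4 (Γ (mm φ (p s).1)) (Γ (pt φ i ⟨(p s).1, hRi _ (hm1 s)⟩ y))
    (Γ (pt φ i ⟨x0, hx0i⟩ y)) (Γ (mm φ (p s).2))
  have t2 := dist_triangle_left (Γ (pt φ i ⟨x0, hx0i⟩ y)) (Γ (mm φ (p s).2))
    (Γ (pt φ i ⟨(p s).2, hRi _ (hm2 s)⟩ y))
  rw [dist_comm] at e1
  linarith

lemma zz_LInd_ge (hφ : ZPhiOK φ) (hι : tWeight C < #ι) {L : Type} [MetricSpace L] [CompactSpace L]
    [Nonempty L] {α : Ordinal.{0}} (hZ : LIndLE L (ZZ φ) (Order.succ α)) : LIndLE L C α := by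
  by_contra hC
  have hC' := hC
  rw [LIndLE_iff] at hC'
  push Not at hC'
  obtain ⟨F, hF, f, hf⟩ := hC'
  rw [LIndLE_iff] at hZ
  have := zz_compact hφ.1
  have hmem : ∀ z : ↥(mm φ '' F), pr z.1 ∈ F := by
    rintro ⟨_, x, hx, rfl⟩
    rw [pr_mm]; exact hx
  obtain ⟨U, hU, hFU, ⟨g, hg⟩, hdim⟩ := hZ (mm φ '' F) (mm_emb.isClosedMap _ hF)
    ⟨fun z => f ⟨pr z.1, hmem z⟩,
      f.continuous.comp ((pr_cont.comp continuous_subtype_val).subtype_mk _)⟩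
  obtain ⟨l0⟩ := ‹Nonempty L›
  let Γ : ZZ φ → L := fun z => if h : z ∈ U then g ⟨z, h⟩ else l0
  have hΓU : ∀ z (h : z ∈ U), Γ z = g ⟨z, h⟩ := fun z h => dif_pos h
  have hΓ : ContinuousOn Γ U := by
    rw [continuousOn_iff_continuous_domRestrict]
    refine g.continuous.congr fun z => ?_
    exact (hΓU z.1 z.2).symm
  set V := mm φ ⁻¹' U with hV
  have hVo : IsOpen V := hU.preimage mm_cont
  have hγ : ContinuousOn (fun x => Γ (mm φ x)) V := hΓ.comp mm_cont.continuousOn fun x hx => hx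
  have hFV : F ⊆ V := fun x hx => hFU ⟨x, hx, rfl⟩
  have hγF : ∀ x (hx : x ∈ F), Γ (mm φ x) = f ⟨x, hx⟩ := by
    intro x hx
    rw [hΓU _ (hFV hx)]
    refine (hg (mm φ x) ⟨x, hx, rfl⟩).trans ?_
    simp
  have hfin : ∀ (U' : Set C), IsOpen U' → V ⊆ U' → ∀ γ' : C → L, ContinuousOn γ' U' →
      (∀ x ∈ V, γ' x = Γ (mm φ x)) → ¬ (U'ᶜ = ∅ ∨ ∃ β < α, LIndLE L (↥U'ᶜ) β) := by
    intro U' hU' hVU γ' hγ' hγV hd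
    have h1 := hf U' hU' (hFV.trans hVU) ⟨⟨U'.domRestrict γ', hγ'.domRestrict⟩, fun x hx => by
      change γ' x = _
      rw [hγV x (hFV hx), hγF x hx]⟩
    rcases hd with hd | ⟨β, hβ, hd⟩
    · exact h1.1.ne_empty hd
    · exact h1.2 β hβ hd
  rcases hdim with hd | ⟨β, hβ, hd⟩
  · refine hfin V hVo Subset.rfl _ hγ (fun _ _ => rfl) (Or.inl ?_)
    rw [hV, ← preimage_compl, hd, preimage_empty]
  · have hd' := LIndLE_mono (Order.lt_succ_iff.1 hβ) hd
    have hcl := hU.isClosed_compl.isClosedEmbedding_subtypeVal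
    have hP : LIndLE L (↥Vᶜ) α := by
      refine LIndLE_closedEmb α (fun x => (⟨mm φ x.1, x.2⟩ : ↥Uᶜ)) ?_ hd'
      exact (IsClosedEmbedding.of_comp_iff hcl).1
        (mm_emb.comp hVo.isClosed_compl.isClosedEmbedding_subtypeVal)
    by_cases hlim : ∀ x ∈ closure V, ∃ l, Filter.Tendsto (fun x => Γ (mm φ x)) (𝓝[V] x) (𝓝 l)
    · obtain ⟨U', hU', hVU, ⟨γ', hγ', hγV⟩, hd2⟩ := glueL hVo _ hγ hlim hP
      exact hfin U' hU' hVU γ' hγ' hγV hd2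
    · push Not at hlim
      obtain ⟨x0, hx0, hno⟩ := hlim
      obtain ⟨i, s, his⟩ := zz_key hφ hι hU Γ hΓ hx0 (by push Not; exact hno)
      refine hC (LIndLE_closedEmb α (fun y => (⟨pt φ i s y, his y⟩ : ↥Uᶜ)) ?_ hd')
      exact (IsClosedEmbedding.of_comp_iff hcl).1 (pt_emb_y i s)

end ZZ

lemma ofOrdinal_inj {a b : Ordinal.{0}} (h : Dim.ofOrdinal a = Dim.ofOrdinal b) : a = b :=
  WithBot.coe_injective (WithTop.coe_injective h)

lemma covDim_spec {C : Type} [TopologicalSpace C] [Nonempty C] {d : ℕ}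
    (h : covDim C = Dim.ofOrdinal ((d : ℕ) : Ordinal.{0})) :
    CovDimLE C d ∧ ∀ m < d, ¬ CovDimLE C m := by
  unfold covDim at h
  rw [if_neg (not_isEmpty_of_nonempty C)] at h
  split_ifs at h with hex
  · have h1 : sInf {n | CovDimLE C n} = d := by exact_mod_cast ofOrdinal_inj h
    have h2 : sInf {n | CovDimLE C n} ∈ {n | CovDimLE C n} := Nat.sInf_mem hex
    rw [h1] at h2
    refine ⟨h2, fun m hm hc => ?_⟩
    have h3 : sInf {n | CovDimLE C n} ≤ m := Nat.sInf_le hc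
    omega
  · exact absurd h (WithTop.coe_ne_top).symm

lemma sInf_eq_of {S : Set Ordinal.{0}} {a : Ordinal.{0}} (ha : a ∈ S) (h : ∀ b ∈ S, a ≤ b) :
    sInf S = a :=
  le_antisymm (csInf_le' ha) (le_csInf ⟨a, ha⟩ h)

theorem statement19 (k n : ℕ) (hk : 2 ≤ k) (hn : 1 ≤ n)
    (C : Type) [MetricSpace C] [CompactSpace C] [ConnectedSpace C]
    (hdim : covDim C = Dim.ofOrdinal ((k * n : ℕ) : Ordinal.{0}))
    (ι : Type) [TopologicalSpace ι] [DiscreteTopology ι]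
    (hι : ZCardOK C C ι) (φ : ι → Set C) (hφ : ZPhiOK φ) :
    CompactSpace (ZSpace ι C C φ) ∧ FrechetUrysohnSpace (ZSpace ι C C φ) ∧
    KDim (bComplex k) (ZSpace ι C C φ) = Dim.ofOrdinal ((n : ℕ) : Ordinal.{0}) ∧
    KInd (bComplex k) (ZSpace ι C C φ) = Dim.ofOrdinal ((n : ℕ) : Ordinal.{0}) ∧
    LInd (↥(Metric.sphere (0 : EuclideanSpace ℝ (Fin k)) 1)) (ZSpace ι C C φ) =
      Dim.ofOrdinal ((n + 1 : ℕ) : Ordinal.{0}) ∧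
    ∀ z : ZSpace ι C C φ, Nonempty (↥(connectedComponent z) ≃ₜ C) := by
  have hcomp : CompactSpace (ZZ φ) := zz_compact hφ.1
  obtain ⟨hd1, hd2⟩ := covDim_spec hdim
  obtain ⟨n', rfl⟩ : ∃ n', n = n' + 1 := ⟨n - 1, by omega⟩
  have hQ : QD C (k * (n' + 1) + 1) := hd1.QD
  have hnotC : ∀ m : ℕ, m < n' + 1 → ¬ KDimO k C (m + 1) := by
    intro m hm h
    have h1 : (m + 1) * k ≤ k * (n' + 1) := by
      rw [mul_comm]; exact Nat.mul_le_mul_left k hm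
    have h2 : 1 ≤ (m + 1) * k := Nat.mul_pos (Nat.succ_pos m) (by omega)
    exact hd2 _ (by omega) (covDim_of_KDimO h h2)
  have hnotZ : ∀ m : ℕ, m < n' + 1 → ¬ KDimO k (ZZ φ) (m + 1) := fun m hm h =>
    hnotC m hm (h.closedEmb (mm φ) mm_emb)
  have hK : KIndLE (bComplex k) (ZZ φ) ((n' + 1 : ℕ) : Ordinal.{0}) :=
    zz_KInd_le hφ.1 hk (by rw [add_comm]; exact hQ)
  have hL : LIndLE (Sph k) (ZZ φ) ((n' + 2 : ℕ) : Ordinal.{0}) :=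
    zz_LInd_le hφ.1 (by omega) (hQ.pad (by omega))
  have hne : ¬ IsEmpty (ZZ φ) := fun h => h.elim (mm φ (Classical.arbitrary C))
  have hnat : ∀ (α : Ordinal.{0}) (N : ℕ), α < (N : Ordinal.{0}) → ∃ m : ℕ, m < N ∧ α = m := by
    intro α N h
    obtain ⟨m, rfl⟩ := Ordinal.lt_omega0.1 (h.trans (Ordinal.natCast_lt_omega0 N))
    exact ⟨m, by exact_mod_cast h, rfl⟩
  refine ⟨hcomp, zz_frechet hφ.1, ?_, ?_, ?_, zz_component hφ.1⟩
  · have hD : KDimLE (bComplex k) (ZZ φ) (n' + 1) := (KDimLE_iff _ _ _).2 (hK.kdim (n' + 1))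
    unfold KDim
    rw [if_neg hne, if_pos ⟨_, hD⟩]
    congr 2
    refine le_antisymm (Nat.sInf_le hD) (le_csInf ⟨_, hD⟩ fun m hm => ?_)
    by_contra hlt
    exact hnotZ m (not_le.1 hlt) ((KDimLE_iff _ _ _).1 hm)
  · unfold KInd
    rw [if_neg hne, if_pos ⟨_, hK⟩]
    congr 1
    refine sInf_eq_of hK fun α hα => ?_
    by_contra hlt
    obtain ⟨m, hm, rfl⟩ := hnat α _ (not_le.1 hlt)
    exact hnotZ m hm (KIndLE.kdim m hα)
  · unfold LInd
    rw [if_neg hne, if_pos ⟨_, hL⟩]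
    congr 1
    refine sInf_eq_of hL fun α hα => ?_
    by_contra hlt
    obtain ⟨m, hm, rfl⟩ := hnat α _ (not_le.1 hlt)
    have h1 : LIndLE (Sph k) (ZZ φ) (Order.succ ((n' : ℕ) : Ordinal.{0})) := by
      refine LIndLE_mono ?_ hα
      rw [Order.succ_eq_add_one]
      exact_mod_cast Nat.lt_succ_iff.1 hm
    have : Nonempty (Sph k) :=
      ⟨⟨EuclideanSpace.single ⟨0, by omega⟩ 1, by simp⟩⟩
    have h2 := zz_LInd_ge hφ hι.2.1 h1
    exact hnotC n' (Nat.lt_succ_self _) (KIndLE.kdim n' (LIndLE.toK _ h2))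

end
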